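/- arXiv:2004.03724 — 5 statements merged into one kernel-verified Lean document; each statement's English description precedes it below -/
import Mathlib

section
/- There is an absolute constant c₁ > 0 (one may take c₁ = 1/800) such that for each b ∈ (0, π], each n ∈ ℕ and every trigonometric polynomial T of degree ≤ n, one has max_{|x| ≤ b} | |x| − T(x) | ≥ c₁ b / n. -/
noncomputable section

/-- `T ∈ 𝒯_n`: a real trigonometric polynomial of degree at most `n`. -/
def IsTrigPoly (n : ℕ) (T : ℝ → ℝ) : Prop :=
  ∃ a b : ℕ → ℝ, ∀ t : ℝ,
    T t = a 0 + ∑ k ∈ Finset.Icc 1 n, (a k * Real.cos (k * t) + b k * Real.sin (k * t))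

/-- `f` is entire, and of exponential growth of rate at most `N` in the imaginary direction. -/
def HasStripGrowth (N : ℝ) (f : ℂ → ℂ) : Prop :=
  Differentiable ℂ f ∧ ∃ C : ℝ, ∀ z : ℂ, ‖f z‖ ≤ C * Real.exp (N * |z.im|)

namespace HasStripGrowth

variable {N A : ℝ} {f g : ℂ → ℂ}

theorem comp_neg (hf : HasStripGrowth N f) : HasStripGrowth N fun z => f (-z) := by
  obtain ⟨hd, C, hC⟩ := hf
  exact ⟨hd.comp differentiable_neg, C, fun z => by simpa using hC (-z)⟩

theorem comp_add_ofReal (hf : HasStripGrowth N f) (h : ℝ) :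
    HasStripGrowth N fun z => f (z + h) := by
  obtain ⟨hd, C, hC⟩ := hf
  exact ⟨hd.comp (differentiable_id.add_const _), C, fun z => by simpa using hC (z + h)⟩

theorem add (hf : HasStripGrowth N f) (hg : HasStripGrowth N g) :
    HasStripGrowth N fun z => f z + g z := by
  obtain ⟨hd, C, hC⟩ := hf
  obtain ⟨hd', C', hC'⟩ := hg
  refine ⟨hd.add hd', C + C', fun z => ?_⟩
  rw [add_mul]
  exact norm_add_le_of_le (hC z) (hC' z)

theorem const_mul (hf : HasStripGrowth N f) (c : ℂ) : HasStripGrowth N fun z => c * f z := by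
  obtain ⟨hd, C, hC⟩ := hf
  refine ⟨hd.const_mul c, ‖c‖ * C, fun z => ?_⟩
  rw [norm_mul, mul_assoc]
  exact mul_le_mul_of_nonneg_left (hC z) (norm_nonneg c)

/-- A bound on the real axis propagates to the lower half-plane (Phragmén–Lindelöf). -/
theorem norm_le_of_im_nonpos (hf : HasStripGrowth N f) (hA : ∀ x : ℝ, ‖f x‖ ≤ A) {z : ℂ}
    (hz : z.im ≤ 0) : ‖f z‖ ≤ A * Real.exp (N * |z.im|) := by
  obtain ⟨hd, C, hC⟩ := hf
  set F : ℂ → ℂ := fun w => f (-Complex.I * w) * Complex.exp (-N * w) with hF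
  have hFd : Differentiable ℂ F := by
    refine (hd.comp (differentiable_id.const_mul _)).mul ?_
    exact (differentiable_id.const_mul _).cexp
  have hnorm : ∀ w, ‖F w‖ = ‖f (-Complex.I * w)‖ * Real.exp (-N * w.re) := fun w => by
    simp [hF, Complex.norm_exp]
  have hbound : ∀ w : ℂ, 0 ≤ w.re → ‖F w‖ ≤ C := fun w hw => by
    rw [hnorm]
    have h := hC (-Complex.I * w)
    have him : (-Complex.I * w).im = -w.re := by simp
    rw [him, abs_neg, abs_of_nonneg hw] at h
    calc _ ≤ C * Real.exp (N * w.re) * Real.exp (-N * w.re) := by gcongr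
      _ = C := by rw [mul_assoc, ← Real.exp_add]; simp
  have key : ‖F (Complex.I * z)‖ ≤ A := by
    refine PhragmenLindelof.right_half_plane_of_bounded_on_real hFd.diffContOnCl
      ⟨1, by norm_num, 0, ?_⟩ ?_ ?_ (by simpa using hz)
    · refine Asymptotics.IsBigO.of_bound C ?_
      refine Filter.eventually_inf_principal.2 (Filter.Eventually.of_forall fun w hw => ?_)
      simpa using hbound w (le_of_lt hw)
    · refine Filter.isBoundedUnder_of_eventually_le (a := C) ?_
      filter_upwards [Filter.eventually_ge_atTop 0] with x hx
      exact hbound x (by simpa using hx)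
    · intro x
      rw [hnorm]
      have h1 : -Complex.I * (x * Complex.I) = (x : ℂ) := by
        linear_combination (-(x : ℂ)) * Complex.I_mul_I
      rw [h1]
      simpa using hA x
  rw [hnorm] at key
  have h1 : -Complex.I * (Complex.I * z) = z := by
    linear_combination (-z) * Complex.I_mul_I
  have h2 : (Complex.I * z).re = |z.im| := by simp [abs_of_nonpos hz]
  rw [h1, h2] at key
  calc ‖f z‖ = ‖f z‖ * Real.exp (-N * |z.im|) * Real.exp (N * |z.im|) := by
        rw [mul_assoc, ← Real.exp_add]; simp
    _ ≤ _ := by gcongr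

theorem norm_le (hf : HasStripGrowth N f) (hA : ∀ x : ℝ, ‖f x‖ ≤ A) (z : ℂ) :
    ‖f z‖ ≤ A * Real.exp (N * |z.im|) := by
  rcases le_total z.im 0 with hz | hz
  · exact hf.norm_le_of_im_nonpos hA hz
  · simpa using hf.comp_neg.norm_le_of_im_nonpos (A := A) (fun x => by simpa using hA (-x))
      (z := -z) (by simpa using hz)

/-- A Bernstein-type inequality: `f` is Lipschitz at the origin with constant `4 * A * N`. -/
theorem norm_sub_le (hf : HasStripGrowth N f) (hN : 0 < N) (hA : ∀ x : ℝ, ‖f x‖ ≤ A) {z : ℂ}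
    (hz : ‖z‖ < 1 / N) : ‖f z - f 0‖ ≤ 4 * A * N * ‖z‖ := by
  have hA0 : 0 ≤ A := (norm_nonneg _).trans (hA 0)
  have hmaps : Set.MapsTo f (Metric.ball 0 (1 / N)) (Metric.closedBall (f 0) (4 * A)) := by
    intro w hw
    rw [mem_ball_zero_iff, lt_div_iff₀ hN] at hw
    have hle : N * |w.im| ≤ 1 := by
      nlinarith [Complex.abs_im_le_norm w]
    have h1 : ‖f w‖ ≤ A * 3 := by
      refine (hf.norm_le hA w).trans ?_
      gcongr
      exact (Real.exp_le_exp.2 hle).trans (Real.exp_one_lt_d9.le.trans (by norm_num))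
    have h0 : ‖f 0‖ ≤ A := by simpa using hA 0
    rw [mem_closedBall_iff_norm]
    exact (_root_.norm_sub_le _ _).trans (by linarith)
  have := Complex.dist_le_div_mul_dist_of_mapsTo_ball hf.1.differentiableOn hmaps
    (mem_ball_zero_iff.2 hz)
  rw [dist_eq_norm, dist_zero_right] at this
  simpa [div_eq_mul_inv] using this

/-- A subadditive even function that is uniformly close on `ℝ` to a function of exponential
growth of rate `N` is small at distance `1 / (8 * N)` from the origin. -/
theorem le_of_subadditive (hf : HasStripGrowth N f) (hN : 0 < N) {G : ℝ → ℝ} {M : ℝ}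
    (hG0 : G 0 = 0) (hGneg : ∀ x, G (-x) = G x) (hGadd : ∀ x y, G (x + y) ≤ G x + G y)
    (hM : ∀ x : ℝ, ‖f x - (G x : ℂ)‖ ≤ M) : G (1 / (8 * N)) ≤ 10 * M := by
  set h : ℝ := 1 / (8 * N) with hh
  have hh0 : 0 < h := by positivity
  set S : ℂ → ℂ := fun z => f (z + (h : ℝ)) + f (z + (-h : ℝ)) + (-2) * f z with hS
  have hSg : HasStripGrowth N S :=
    ((hf.comp_add_ofReal h).add (hf.comp_add_ofReal (-h))).add (hf.const_mul (-2))
  have hdiff : ∀ x : ℝ, ‖S x - ((G (x + h) + G (x - h) - 2 * G x : ℝ) : ℂ)‖ ≤ 4 * M := by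
    intro x
    have e : S x - ((G (x + h) + G (x - h) - 2 * G x : ℝ) : ℂ)
        = (f ((x + h : ℝ) : ℂ) - (G (x + h) : ℂ)) + (f ((x - h : ℝ) : ℂ) - (G (x - h) : ℂ))
          + (-2) * (f x - (G x : ℂ)) := by
      simp only [hS]
      push_cast
      rw [← sub_eq_add_neg]
      ring
    rw [e]
    have h3 : ‖(-2 : ℂ) * (f x - (G x : ℂ))‖ ≤ 2 * M := by
      rw [norm_mul]
      simpa using hM x
    exact (norm_add₃_le).trans (by linarith [hM (x + h), hM (x - h)])
  have hSA : ∀ x : ℝ, ‖S x‖ ≤ 2 * G h + 4 * M := by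
    intro x
    have h1 := hGadd x h
    have h2 := hGadd x (-h)
    have h3 := hGadd (x + h) (-h)
    have h4 := hGadd (x - h) h
    rw [hGneg] at h2 h3
    rw [← sub_eq_add_neg] at h2 h3
    rw [add_sub_cancel_right] at h3
    rw [sub_add_cancel] at h4
    have h5 : ‖((G (x + h) + G (x - h) - 2 * G x : ℝ) : ℂ)‖ ≤ 2 * G h := by
      rw [Complex.norm_real, Real.norm_eq_abs, abs_le]
      constructor <;> linarith
    have := norm_le_norm_add_norm_sub' (S x) ((G (x + h) + G (x - h) - 2 * G x : ℝ) : ℂ)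
    linarith [hdiff x]
  have hhN : ‖(h : ℂ)‖ = h := by simp [abs_of_pos hh0]
  have hlip := hSg.norm_sub_le hN hSA (z := (h : ℂ)) (by
    rw [hhN, hh]
    gcongr
    linarith)
  rw [hhN] at hlip
  have hNh : N * h = 1 / 8 := by rw [hh]; field_simp
  have hlip' : ‖S h - S 0‖ ≤ G h + 2 * M := by
    refine hlip.trans (le_of_eq ?_)
    rw [mul_assoc, hNh]
    ring
  have d0 := hdiff 0
  have dh := hdiff h
  rw [zero_add, zero_sub, hGneg, hG0, Complex.ofReal_zero] at d0
  rw [sub_self, hG0] at dh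
  have hsub := hGadd h h
  have r0 := (Complex.abs_re_le_norm _).trans d0
  have rh := (Complex.abs_re_le_norm _).trans dh
  have rl := (Complex.abs_re_le_norm _).trans hlip'
  rw [Complex.sub_re, Complex.ofReal_re, abs_le] at r0 rh
  rw [Complex.sub_re, abs_le] at rl
  linarith [r0.1, rh.2, rl.1]

/-- A polynomial of degree at most `n` in an affine function of `cos z` has growth rate `n`. -/
theorem polynomial_eval_cos (P : Polynomial ℂ) {n : ℕ} (hP : P.natDegree ≤ n) (α γ : ℂ) :
    HasStripGrowth n fun z => P.eval (α + γ * Complex.cos z) := by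
  constructor
  · exact P.differentiable.comp ((Complex.differentiable_cos.const_mul γ).const_add α)
  have hcos : ∀ z : ℂ, ‖Complex.cos z‖ ≤ Real.exp |z.im| := by
    intro z
    have h1 : ‖Complex.exp (z * Complex.I)‖ ≤ Real.exp |z.im| := by
      rw [Complex.norm_exp]
      simpa using neg_le_abs z.im
    have h2 : ‖Complex.exp (-z * Complex.I)‖ ≤ Real.exp |z.im| := by
      rw [Complex.norm_exp]
      simpa using le_abs_self z.im
    rw [Complex.cos, norm_div, Complex.norm_ofNat, div_le_iff₀ two_pos]
    exact (norm_add_le _ _).trans (by linarith)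
  refine ⟨∑ i ∈ Finset.range (n + 1), ‖P.coeff i‖ * (‖α‖ + ‖γ‖) ^ i, fun z => ?_⟩
  have h1 : 1 ≤ Real.exp |z.im| := Real.one_le_exp (abs_nonneg _)
  have hu : ‖α + γ * Complex.cos z‖ ≤ (‖α‖ + ‖γ‖) * Real.exp |z.im| := by
    refine (norm_add_le _ _).trans ?_
    rw [norm_mul, add_mul]
    exact add_le_add (le_mul_of_one_le_right (norm_nonneg _) h1)
      (mul_le_mul_of_nonneg_left (hcos z) (norm_nonneg _))
  beta_reduce
  rw [Polynomial.eval_eq_sum_range' (Nat.lt_succ_of_le hP), Finset.sum_mul]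
  refine norm_sum_le_of_le _ fun i hi => ?_
  rw [norm_mul, norm_pow, mul_assoc, Real.exp_nat_mul]
  gcongr
  calc ‖α + γ * Complex.cos z‖ ^ i ≤ ((‖α‖ + ‖γ‖) * Real.exp |z.im|) ^ i := by gcongr
    _ = (‖α‖ + ‖γ‖) ^ i * Real.exp |z.im| ^ i := mul_pow _ _ _
    _ ≤ _ := by
      gcongr
      exact Nat.lt_succ_iff.1 (Finset.mem_range.1 hi)

end HasStripGrowth

theorem IsTrigPoly.continuous {n : ℕ} {T : ℝ → ℝ} (hT : IsTrigPoly n T) : Continuous T := by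
  obtain ⟨a, b, h⟩ := hT
  rw [funext h]
  fun_prop

/-- The even part of a trigonometric polynomial is a polynomial in the cosine. -/
theorem IsTrigPoly.exists_polynomial_even_part {n : ℕ} {T : ℝ → ℝ} (hT : IsTrigPoly n T) :
    ∃ P : Polynomial ℂ, P.natDegree ≤ n ∧
      ∀ x : ℝ, P.eval (Complex.cos x) = (((T x + T (-x)) / 2 : ℝ) : ℂ) := by
  obtain ⟨a, b, h⟩ := hT
  refine ⟨Polynomial.C (a 0 : ℂ)
    + ∑ k ∈ Finset.Icc 1 n, Polynomial.C (a k : ℂ) * Polynomial.Chebyshev.T ℂ k, ?_, fun x => ?_⟩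
  · refine Polynomial.natDegree_add_le_of_degree_le (by simp) ?_
    refine Polynomial.natDegree_sum_le_of_forall_le _ _ fun k hk => ?_
    refine (Polynomial.natDegree_C_mul_le _ _).trans ?_
    simpa using (Finset.mem_Icc.1 hk).2
  · have e : (T x + T (-x)) / 2 = a 0 + ∑ k ∈ Finset.Icc 1 n, a k * Real.cos (k * x) := by
      simp only [h, mul_neg, Real.cos_neg, Real.sin_neg, Finset.sum_add_distrib,
        Finset.sum_neg_distrib]
      ring
    rw [e, Polynomial.eval_add, Polynomial.eval_finsetSum]
    simp [Polynomial.Chebyshev.T_complex_cos]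

/-- `θ ↦ arcsin (β * |sin θ|)` is subadditive for `0 ≤ β ≤ 1`. -/
theorem arcsin_mul_abs_sin_add_le {β : ℝ} (h0 : 0 ≤ β) (h1 : β ≤ 1) (u v : ℝ) :
    Real.arcsin (β * |Real.sin (u + v)|)
      ≤ Real.arcsin (β * |Real.sin u|) + Real.arcsin (β * |Real.sin v|) := by
  have hmem : ∀ t : ℝ, 0 ≤ β * |Real.sin t| ∧ β * |Real.sin t| ≤ 1 := fun t =>
    ⟨by positivity, mul_le_one₀ h1 (abs_nonneg _) (Real.abs_sin_le_one t)⟩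
  have hcos : ∀ t : ℝ, |Real.cos t| ≤ Real.cos (Real.arcsin (β * |Real.sin t|)) := fun t => by
    rw [Real.cos_arcsin]
    refine Real.abs_le_sqrt ?_
    rw [mul_pow, sq_abs]
    nlinarith [Real.sin_sq_add_cos_sq t, sq_nonneg (Real.sin t), mul_le_one₀ h1 h0 h1]
  have hsin : ∀ t : ℝ, Real.sin (Real.arcsin (β * |Real.sin t|)) = β * |Real.sin t| := fun t =>
    Real.sin_arcsin (by linarith [(hmem t).1]) (hmem t).2
  have hu := Real.arcsin_nonneg.2 (hmem u).1
  have hv := Real.arcsin_nonneg.2 (hmem v).1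
  rcases le_total (Real.arcsin (β * |Real.sin u|) + Real.arcsin (β * |Real.sin v|))
    (Real.pi / 2) with hle | hle
  · rw [Real.arcsin_le_iff_le_sin ⟨by linarith [(hmem (u + v)).1], (hmem (u + v)).2⟩
      ⟨by linarith [Real.pi_pos], hle⟩,
      Real.sin_add (Real.arcsin _), hsin, hsin]
    calc β * |Real.sin (u + v)|
        ≤ β * (|Real.sin u| * |Real.cos v| + |Real.cos u| * |Real.sin v|) := by
          rw [Real.sin_add, ← abs_mul, ← abs_mul]
          gcongr
          exact abs_add_le _ _
      _ = β * |Real.sin u| * |Real.cos v| + |Real.cos u| * (β * |Real.sin v|) := by ring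
      _ ≤ _ := by
          gcongr
          · exact hcos v
          · exact hcos u
  · exact (Real.arcsin_le_pi_div_two _).trans hle

/-- If a trigonometric polynomial of degree at most `n` is within `M` of `|x|` on `[-b, b]`, then
`M` is at least of order `b / n`. -/
theorem IsTrigPoly.div_le_of_forall_abs_sub_le {n : ℕ} (hn : 1 ≤ n) {T : ℝ → ℝ}
    (hT : IsTrigPoly n T) {b M : ℝ} (hb : b ∈ Set.Ioc 0 Real.pi)
    (hM : ∀ x ∈ Set.Icc (-b) b, |abs x - T x| ≤ M) : b / (400 * n) ≤ M := by
  obtain ⟨hb0, hbπ⟩ := hb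
  have hn1 : (1 : ℝ) ≤ n := by exact_mod_cast hn
  have hn0 : (0 : ℝ) < n := by linarith
  have hπ := Real.pi_pos
  obtain ⟨P, hPdeg, hP⟩ := hT.exists_polynomial_even_part
  set β := Real.sin (b / 2) with hβ
  have hβ0 : 0 ≤ β := Real.sin_nonneg_of_nonneg_of_le_pi (by linarith) (by linarith)
  have hβ1 : β ≤ 1 := Real.sin_le_one _
  set G : ℝ → ℝ := fun φ => 2 * Real.arcsin (β * |Real.sin (φ / 2)|) with hG
  have hGb : ∀ φ, 0 ≤ G φ ∧ G φ ≤ b := fun φ => by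
    refine ⟨mul_nonneg two_pos.le (Real.arcsin_nonneg.2 (by positivity)), ?_⟩
    have : Real.arcsin (β * |Real.sin (φ / 2)|) ≤ Real.arcsin β :=
      Real.arcsin_le_arcsin (mul_le_of_le_one_right hβ0 (Real.abs_sin_le_one _))
    rw [hβ, Real.arcsin_sin (by linarith) (by linarith), ← hβ] at this
    simp only [hG]
    linarith
  have hcosG : ∀ φ, Real.cos (G φ) = (1 - β ^ 2) + β ^ 2 * Real.cos φ := fun φ => by
    have h1 : β * |Real.sin (φ / 2)| ≤ 1 :=
      mul_le_one₀ hβ1 (abs_nonneg _) (Real.abs_sin_le_one _)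
    have h2 : 0 ≤ β * |Real.sin (φ / 2)| := by positivity
    have h3 : Real.cos φ = 1 - 2 * Real.sin (φ / 2) ^ 2 := by
      have h4 := Real.cos_two_mul (φ / 2)
      rw [mul_div_cancel₀ φ two_ne_zero] at h4
      linarith [Real.cos_sq_add_sin_sq (φ / 2)]
    simp only [hG]
    rw [Real.cos_two_mul, Real.cos_sq', Real.sin_arcsin (by linarith) h1, mul_pow, sq_abs, h3]
    ring
  have key := (HasStripGrowth.polynomial_eval_cos P hPdeg ((1 - β ^ 2 : ℝ) : ℂ)
    ((β ^ 2 : ℝ) : ℂ)).le_of_subadditive hn0 (G := G) (M := M) (by simp [hG])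
    (fun x => by simp [hG, neg_div])
    (fun x y => by
      have := arcsin_mul_abs_sin_add_le hβ0 hβ1 (x / 2) (y / 2)
      rw [← add_div] at this
      simp only [hG]
      linarith)
    (fun φ => by
      obtain ⟨h0, h1⟩ := hGb φ
      have e : ((1 - β ^ 2 : ℝ) : ℂ) + ((β ^ 2 : ℝ) : ℂ) * Complex.cos φ
          = Complex.cos ((G φ : ℝ) : ℂ) := by
        rw [← Complex.ofReal_cos (G φ), hcosG]
        push_cast
        ring
      rw [e, hP, ← Complex.ofReal_sub, Complex.norm_real, Real.norm_eq_abs]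
      have m1 := hM (G φ) ⟨by linarith, h1⟩
      have m2 := hM (-G φ) ⟨by linarith, by linarith⟩
      rw [abs_of_nonneg h0, abs_le] at m1
      rw [abs_neg, abs_of_nonneg h0, abs_le] at m2
      rw [abs_le]
      constructor <;> linarith [m1.1, m1.2, m2.1, m2.2])
  set h : ℝ := 1 / (8 * n) with hh
  have hh0 : 0 < h := by positivity
  have hh1 : h ≤ 1 := by
    rw [hh, div_le_one (by positivity)]
    linarith
  have hβl : b / Real.pi ≤ β := by
    refine le_trans (le_of_eq ?_) (Real.mul_le_sin (x := b / 2) (by linarith) (by linarith))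
    field_simp
  have hsl : h / Real.pi ≤ Real.sin (h / 2) := by
    refine le_trans (le_of_eq ?_) (Real.mul_le_sin (x := h / 2) (by linarith)
      (by linarith [Real.pi_gt_three]))
    field_simp
  have hy1 : β * |Real.sin (h / 2)| ≤ 1 :=
    mul_le_one₀ hβ1 (abs_nonneg _) (Real.abs_sin_le_one _)
  have hy0 : 0 ≤ β * |Real.sin (h / 2)| := by positivity
  have harc : β * |Real.sin (h / 2)| ≤ Real.arcsin (β * |Real.sin (h / 2)|) := by
    have := Real.sin_le (Real.arcsin_nonneg.2 hy0)
    rwa [Real.sin_arcsin (by linarith) hy1] at this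
  have hprod : b / Real.pi * (h / Real.pi) ≤ β * |Real.sin (h / 2)| :=
    mul_le_mul hβl (hsl.trans (le_abs_self _)) (by positivity) hβ0
  have hten : b * h / 10 ≤ b / Real.pi * (h / Real.pi) := by
    rw [div_mul_div_comm]
    gcongr
    nlinarith [Real.pi_lt_d2]
  have hfin : b / (400 * n) = b * h / 10 * 2 / 10 := by
    rw [hh]
    field_simp
    norm_num
  have : G h = 2 * Real.arcsin (β * |Real.sin (h / 2)|) := rfl
  rw [hfin]
  linarith

/-- **Lemma 3.3.** There is an absolute constant `c₁ > 0` (one may take `c₁ = 1/800`) such that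
for each `b ∈ (0, π]` and every trigonometric polynomial `T` of degree at most `n`,
`max_{|x| ≤ b} ||x| - T(x)| ≥ c₁ b / n`. -/
theorem abs_value_trig_approx_lower_bound :
    ∃ c₁ : ℝ, 0 < c₁ ∧ c₁ = 1 / 800 ∧
      ∀ b : ℝ, b ∈ Set.Ioc 0 Real.pi → ∀ n : ℕ, 1 ≤ n → ∀ T : ℝ → ℝ, IsTrigPoly n T →
        c₁ * b / n ≤ sSup ((fun x => |abs x - T x|) '' Set.Icc (-b) b) := by
  refine ⟨1 / 800, by norm_num, rfl, fun b hb n hn T hT => ?_⟩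
  have hn0 : (0 : ℝ) < n := by exact_mod_cast hn
  have hcont : Continuous fun x => |abs x - T x| := (continuous_abs.sub hT.continuous).abs
  have hM : ∀ x ∈ Set.Icc (-b) b,
      |abs x - T x| ≤ sSup ((fun x => |abs x - T x|) '' Set.Icc (-b) b) := fun x hx =>
    le_csSup (isCompact_Icc.image hcont).bddAbove (Set.mem_image_of_mem _ hx)
  refine le_trans ?_ (hT.div_le_of_forall_abs_sub_le hn hb hM)
  rw [div_le_div_iff₀ hn0 (by positivity)]
  nlinarith [mul_pos hb.1 hn0]
end
end

section
/- For each integer q ≥ 3 there exists a constant c₂ > 0 (depending only on q) such that for every b > 0 and every function f : [−2b, 2b] → ℝ that is (q−2)-times continuously differentiable with f^{(q−2)} convex on [0, 2b] and f^{(q−2)} concave on [−2b, 0], one has b^{q−2} · max_{|x| ≤ b} |f^{(q−2)}(x)| ≤ c₂ · max_{|x| ≤ 2b} |f(x)|. -/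
noncomputable section

/-- In every subinterval of an interval on which `|f| ≤ M`, some point has its `n`-th derivative
bounded by a constant multiple of `M` over the `n`-th power of the length of the subinterval. -/
theorem exists_abs_iteratedDerivWithin_le (n : ℕ) :
    ∃ C : ℝ, 0 < C ∧ ∀ (A B M : ℝ) (f : ℝ → ℝ), ContDiffOn ℝ n f (Set.Icc A B) →
      (∀ x ∈ Set.Icc A B, |f x| ≤ M) → ∀ c d : ℝ, A ≤ c → c < d → d ≤ B →
      ∃ ξ ∈ Set.Ioo c d, |iteratedDerivWithin n f (Set.Icc A B) ξ| * (d - c) ^ n ≤ C * M := by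
  induction n with
  | zero =>
    refine ⟨1, one_pos, fun A B M f _ hM c d hc hcd hd =>
      ⟨(c + d) / 2, ⟨by linarith, by linarith⟩, ?_⟩⟩
    simpa using hM ((c + d) / 2) ⟨by linarith, by linarith⟩
  | succ n ih =>
    obtain ⟨C, hC, ih⟩ := ih
    refine ⟨6 * 3 ^ n * C, by positivity, fun A B M f hf hM c d hc hcd hd => ?_⟩
    have hAB : A < B := by linarith
    have hf' : ContDiffOn ℝ n f (Set.Icc A B) := hf.of_le (by norm_cast; omega)
    obtain ⟨u, ⟨hu₁, hu₂⟩, hu⟩ := ih A B M f hf' hM c (c + (d - c) / 3) hc (by linarith)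
      (by linarith)
    obtain ⟨v, ⟨hv₁, hv₂⟩, hv⟩ := ih A B M f hf' hM (d - (d - c) / 3) d (by linarith)
      (by linarith) hd
    set g := iteratedDerivWithin n f (Set.Icc A B)
    have hdiff : DifferentiableOn ℝ g (Set.Icc A B) :=
      hf.differentiableOn_iteratedDerivWithin (by norm_cast; omega) (uniqueDiffOn_Icc hAB)
    have huv : u < v := by linarith
    obtain ⟨ξ, ⟨hξ₁, hξ₂⟩, hξ⟩ := exists_hasDerivAt_eq_slope g
      (iteratedDerivWithin (n + 1) f (Set.Icc A B)) huv
      (hdiff.continuousOn.mono (Set.Icc_subset_Icc (by linarith) (by linarith)))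
      (fun x hx => by
        rw [iteratedDerivWithin_succ]
        exact (hdiff x ⟨by linarith [hx.1], by linarith [hx.2]⟩).hasDerivWithinAt.hasDerivAt
          (Icc_mem_nhds (by linarith [hx.1]) (by linarith [hx.2])))
    refine ⟨ξ, ⟨by linarith, by linarith⟩, ?_⟩
    have hlen : 0 < d - c := by linarith
    have hslope : |iteratedDerivWithin (n + 1) f (Set.Icc A B) ξ| * (v - u) = |g v - g u| := by
      rw [hξ, abs_div, abs_of_pos (sub_pos.2 huv), div_mul_cancel₀ _ (sub_pos.2 huv).ne']
    have hthird : |iteratedDerivWithin (n + 1) f (Set.Icc A B) ξ| * ((d - c) / 3) ≤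
        |g v| + |g u| :=
      (mul_le_mul_of_nonneg_left (by linarith) (abs_nonneg _)).trans
        (hslope.le.trans (abs_sub _ _))
    rw [add_sub_cancel_left] at hu
    rw [sub_sub_cancel] at hv
    set L := (d - c) / 3 with hL
    have hLpos : 0 < L := by positivity
    rw [show d - c = 3 * L by linarith]
    calc |iteratedDerivWithin (n + 1) f (Set.Icc A B) ξ| * (3 * L) ^ (n + 1)
        = 3 * 3 ^ n * ((|iteratedDerivWithin (n + 1) f (Set.Icc A B) ξ| * L) * L ^ n) := by
          rw [mul_pow, pow_succ, pow_succ]; ring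
      _ ≤ 3 * 3 ^ n * ((|g v| + |g u|) * L ^ n) := by gcongr
      _ = 3 * 3 ^ n * (|g v| * L ^ n + |g u| * L ^ n) := by ring
      _ ≤ 3 * 3 ^ n * (C * M + C * M) := by gcongr
      _ = 6 * 3 ^ n * C * M := by ring

/-- A convex function on `[0, 2b]` which is at most `K` in absolute value at two points
`u ∈ (b, 5b/4)` and `v ∈ (7b/4, 2b)` is at least `-8K` on `[0, b]`. -/
theorem ConvexOn.neg_eight_mul_le {b K u v x : ℝ} {g : ℝ → ℝ}
    (hg : ConvexOn ℝ (Set.Icc 0 (2 * b)) g)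
    (hu : u ∈ Set.Ioo b (5 * b / 4)) (hv : v ∈ Set.Ioo (7 * b / 4) (2 * b))
    (hgu : |g u| ≤ K) (hgv : |g v| ≤ K) (hx : x ∈ Set.Icc 0 b) : -(8 * K) ≤ g x := by
  obtain ⟨hu₁, hu₂⟩ := hu
  obtain ⟨hv₁, hv₂⟩ := hv
  obtain ⟨hx₁, hx₂⟩ := hx
  have hK : 0 ≤ K := (abs_nonneg _).trans hgu
  have hslope := hg.slope_mono_adjacent (x := x) (y := u) (z := v)
    ⟨hx₁, by linarith⟩ ⟨by linarith, by linarith⟩ (by linarith) (by linarith)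
  rw [div_le_div_iff₀ (by linarith) (by linarith)] at hslope
  have hgu' := (abs_le.1 hgu).1
  have hgv' := (abs_le.1 hgv).2
  by_contra! hlt
  have h₁ : (7 * K) * (v - u) < (g u - g x) * (v - u) :=
    mul_lt_mul_of_pos_right (by linarith) (by linarith)
  have h₂ : (g v - g u) * (u - x) ≤ (2 * K) * (u - x) :=
    mul_le_mul_of_nonneg_right (by linarith) (by linarith)
  have h₃ : K * (2 * (u - x)) ≤ K * (7 * (v - u)) :=
    mul_le_mul_of_nonneg_left (by linarith) hK
  linarith

/-- **Lemma 4.1 (from [LS]).** For each `q ≥ 3` there is `c₂ = c₂(q) > 0` such that if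
`f ∈ C^{q-2}[-2b, 2b]` has `f^{(q-2)}` convex on `[0, 2b]` and concave on `[-2b, 0]`, then
`b^{q-2} max_{|x| ≤ b} |f^{(q-2)}(x)| ≤ c₂ max_{|x| ≤ 2b} |f(x)|`. -/
theorem markov_type_co_convex (q : ℕ) (hq : 3 ≤ q) :
    ∃ c₂ : ℝ, 0 < c₂ ∧ ∀ b : ℝ, 0 < b → ∀ f : ℝ → ℝ,
      ContDiffOn ℝ (q - 2 : ℕ) f (Set.Icc (-(2 * b)) (2 * b)) →
      ConvexOn ℝ (Set.Icc 0 (2 * b))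
        (iteratedDerivWithin (q - 2) f (Set.Icc (-(2 * b)) (2 * b))) →
      ConcaveOn ℝ (Set.Icc (-(2 * b)) 0)
        (iteratedDerivWithin (q - 2) f (Set.Icc (-(2 * b)) (2 * b))) →
      b ^ (q - 2) *
          sSup ((fun x => |iteratedDerivWithin (q - 2) f (Set.Icc (-(2 * b)) (2 * b)) x|) ''
            Set.Icc (-b) b) ≤
        c₂ * sSup ((fun x => |f x|) '' Set.Icc (-(2 * b)) (2 * b)) := by
  obtain ⟨C, hC, hsmall⟩ := exists_abs_iteratedDerivWithin_le (q - 2)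
  refine ⟨8 * (C * 4 ^ (q - 2)), by positivity, fun b hb f hf hconv hconc => ?_⟩
  set M := sSup ((fun x => |f x|) '' Set.Icc (-(2 * b)) (2 * b))
  set g := iteratedDerivWithin (q - 2) f (Set.Icc (-(2 * b)) (2 * b))
  have hfM : ∀ x ∈ Set.Icc (-(2 * b)) (2 * b), |f x| ≤ M := fun x hx =>
    le_csSup (isCompact_Icc.image_of_continuousOn hf.continuousOn.abs).bddAbove
      (Set.mem_image_of_mem _ hx)
  set K := C * 4 ^ (q - 2) * M / b ^ (q - 2) with hK
  have hpoint : ∀ c, -(2 * b) ≤ c → c + b / 4 ≤ 2 * b →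
      ∃ ξ ∈ Set.Ioo c (c + b / 4), |g ξ| ≤ K := by
    intro c hc hd
    obtain ⟨ξ, hξ, h⟩ := hsmall _ _ M f hf hfM c (c + b / 4) hc (by linarith) hd
    refine ⟨ξ, hξ, ?_⟩
    rw [add_sub_cancel_left, div_pow, ← mul_div_assoc, div_le_iff₀ (by positivity)] at h
    rw [hK, le_div_iff₀ (by positivity)]
    linarith
  have hneg : ConvexOn ℝ (Set.Icc 0 (2 * b)) (fun x => -g (-x)) := by
    refine ⟨convex_Icc _ _, fun x hx y hy s t hs ht hst => ?_⟩
    have h := hconc.2 (x := -x) (y := -y) ⟨by linarith [hx.2], by linarith [hx.1]⟩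
      ⟨by linarith [hy.2], by linarith [hy.1]⟩ hs ht hst
    simp only [smul_eq_mul] at h ⊢
    rw [show -(s * x + t * y) = s * -x + t * -y by ring]
    linarith
  obtain ⟨u, ⟨hu₁, hu₂⟩, hgu⟩ := hpoint b (by linarith) (by linarith)
  obtain ⟨v, ⟨hv₁, hv₂⟩, hgv⟩ := hpoint (7 * b / 4) (by linarith) (by linarith)
  obtain ⟨u', ⟨hu'₁, hu'₂⟩, hgu'⟩ := hpoint (-(5 * b / 4)) (by linarith) (by linarith)
  obtain ⟨v', ⟨hv'₁, hv'₂⟩, hgv'⟩ := hpoint (-(2 * b)) (by linarith) (by linarith)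
  have hK₀ : 0 ≤ K := (abs_nonneg _).trans hgu
  have hlower : ∀ x ∈ Set.Icc 0 b, -(8 * K) ≤ g x := fun x hx =>
    hconv.neg_eight_mul_le ⟨hu₁, by linarith⟩ ⟨hv₁, by linarith⟩ hgu hgv hx
  have hupper : ∀ x ∈ Set.Icc 0 b, -(8 * K) ≤ -g (-x) := fun x hx =>
    hneg.neg_eight_mul_le (u := -u') (v := -v') ⟨by linarith, by linarith⟩
      ⟨by linarith, by linarith⟩ (by simpa using hgu') (by simpa using hgv') hx
  have hzero₁ := hlower 0 ⟨le_rfl, hb.le⟩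
  have hzero₂ := hupper 0 ⟨le_rfl, hb.le⟩
  rw [neg_zero] at hzero₂
  have hbound : ∀ x ∈ Set.Icc (-b) b, |g x| ≤ 8 * K := by
    rintro x ⟨hx₁, hx₂⟩
    rw [abs_le]
    rcases le_total 0 x with hx | hx
    · refine ⟨hlower x ⟨hx, hx₂⟩, ?_⟩
      have h := hconv.le_max_of_mem_Icc (x := 0) (y := v) (z := x)
        ⟨le_rfl, by linarith⟩ ⟨by linarith, by linarith⟩ ⟨hx, by linarith⟩
      exact h.trans (max_le (by linarith) (by linarith [(abs_le.1 hgv).2]))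
    · have hup := hupper (-x) ⟨by linarith, by linarith⟩
      rw [neg_neg] at hup
      refine ⟨?_, by linarith⟩
      have h := hconc.min_le_of_mem_Icc (x := v') (y := 0) (z := x)
        ⟨by linarith, by linarith⟩ ⟨by linarith, le_rfl⟩ ⟨by linarith, hx⟩
      exact (le_min (by linarith [(abs_le.1 hgv').1]) (by linarith)).trans h
  have hsup : sSup ((fun x => |g x|) '' Set.Icc (-b) b) ≤ 8 * K := by
    refine csSup_le ((Set.nonempty_Icc.2 (by linarith)).image _) ?_
    rintro _ ⟨x, hx, rfl⟩
    exact hbound x hx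
  calc b ^ (q - 2) * sSup ((fun x => |g x|) '' Set.Icc (-b) b) ≤ b ^ (q - 2) * (8 * K) := by
        gcongr
    _ = 8 * (C * 4 ^ (q - 2)) * M := by
        rw [hK]; field_simp
end
end

section
/- For each r ∈ ℕ there exists a constant c₃ > 0 (depending only on r) such that for every b ∈ (0, π], every n ∈ ℕ, every trigonometric polynomial T of degree ≤ n satisfying t · T^{(r+1)}(t) ≥ 0 for all |t| ≤ b, and every algebraic polynomial P of degree ≤ r with real coefficients, one has n · max_{|x| ≤ b} | F_r(x) + P(x) − T(x) | ≥ c₃ b^r. -/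
noncomputable section

/-- `F_r(x) = |x| x^{r-1} / r!`. -/
def Fr (r : ℕ) (x : ℝ) : ℝ := |x| * x ^ (r - 1) / (Nat.factorial r)

open Polynomial in
/-- A polynomial of degree at most `n` bounded by `1` on `[-1, 1]` deviates from its value at the
endpoint `1` no more than the Chebyshev polynomial does on the other side of the endpoint. -/
theorem abs_eval_one_sub_sub_eval_one_le {n : ℕ} {p : ℝ[X]} (hdeg : p.natDegree ≤ n)
    (hp : ∀ x ∈ Set.Icc (-1 : ℝ) 1, |p.eval x| ≤ 1) {δ : ℝ} (hδ : 0 ≤ δ) :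
    |p.eval (1 - δ) - p.eval 1| ≤ (Chebyshev.T ℝ n).eval (1 + δ) - 1 := by
  have hcoeff (q : ℝ[X]) (k : ℕ) :
      (k.factorial : ℝ) * (taylor 1 q).coeff k = (derivative^[k] q).eval 1 := by
    rw [taylor_coeff, ← factorial_smul_hasseDeriv]
    simp
  have hle (q : ℝ[X]) (hq : q.natDegree ≤ n) (hq' : ∀ x ∈ Set.Icc (-1 : ℝ) 1, |q.eval x| ≤ 1)
      (k : ℕ) : (taylor 1 q).coeff k ≤ (taylor 1 (Chebyshev.T ℝ n)).coeff k := by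
    have h := Chebyshev.eval_iterate_derivative_le_of_forall_abs_le_one (k := k) le_rfl
      (natDegree_le_iff_degree_le.mp hq) hq'
    rw [← hcoeff, ← hcoeff] at h
    exact le_of_mul_le_mul_left h (by positivity)
  have habs (k : ℕ) : |(taylor 1 p).coeff k| ≤ (taylor 1 (Chebyshev.T ℝ n)).coeff k := by
    have h := hle (-p) (by simpa using hdeg) (by simpa using hp) k
    rw [map_neg, coeff_neg] at h
    exact abs_le.mpr ⟨by linarith, hle p hdeg hp k⟩
  have hexp (q : ℝ[X]) (hq : q.natDegree ≤ n) (y : ℝ) :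
      q.eval (1 + y) - q.eval 1 =
        ∑ k ∈ Finset.range n, (taylor 1 q).coeff (k + 1) * y ^ (k + 1) := by
    rw [add_comm, ← taylor_eval, eval_eq_sum_range' (n := n + 1) (by rw [natDegree_taylor]; omega),
      Finset.sum_range_succ']
    simp
  have hT : (Chebyshev.T ℝ n).eval 1 = 1 := by simp
  have h1 := hexp (Chebyshev.T ℝ n) (by simp [Chebyshev.natDegree_T]) δ
  rw [hT] at h1
  rw [h1, sub_eq_add_neg 1 δ, hexp p hdeg]
  refine (Finset.abs_sum_le_sum_abs _ _).trans (Finset.sum_le_sum fun k _ => ?_)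
  rw [abs_mul, abs_pow, abs_neg, abs_of_nonneg hδ]
  exact mul_le_mul_of_nonneg_right (habs _) (by positivity)

open Polynomial in
/-- A polynomial of degree at most `n` bounded by `M` on `[-1, 1]` varies by at most `M / 8` at
distance `1 / (32 n ^ 2)` from the endpoint `1`. -/
theorem abs_eval_sub_eval_one_le {n : ℕ} {p : ℝ[X]} (hdeg : p.natDegree ≤ n) {M : ℝ} (hM : 0 < M)
    (hp : ∀ x ∈ Set.Icc (-1 : ℝ) 1, |p.eval x| ≤ M) {x : ℝ} (hx : x ≤ 1)
    (hx' : 32 * n ^ 2 * (1 - x) ≤ 1) :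
    |p.eval x - p.eval 1| ≤ M / 8 := by
  set φ := Real.arcosh (1 + (1 - x)) with hφ
  have hcosh : Real.cosh φ = 1 + (1 - x) := Real.cosh_arcosh (by linarith)
  have hφ2 : φ ^ 2 ≤ 2 * (1 - x) := by
    have h1 : (φ / 2) ^ 2 ≤ Real.sinh (φ / 2) ^ 2 := by
      rw [sq_le_sq, Real.abs_sinh]
      exact Real.self_le_sinh_iff.mpr (abs_nonneg _)
    have h2 := Real.cosh_two_mul (φ / 2)
    rw [mul_div_cancel₀ _ two_ne_zero, hcosh, Real.cosh_sq] at h2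
    nlinarith
  have hT : (Chebyshev.T ℝ n).eval (1 + (1 - x)) ≤ 1 + 1 / 8 := by
    rw [← hcosh, Chebyshev.T_real_cosh]
    refine (Real.cosh_le_exp_half_sq _).trans ?_
    have hsq : ((n : ℤ) * φ : ℝ) ^ 2 / 2 ≤ 1 / 32 := by
      push_cast
      have : (n : ℝ) ^ 2 * φ ^ 2 ≤ n ^ 2 * (2 * (1 - x)) := by gcongr
      nlinarith
    refine (Real.exp_le_exp.mpr hsq).trans ?_
    have h := Real.exp_bound_div_one_sub_of_interval (x := 1 / 32) (by norm_num) (by norm_num)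
    exact h.trans (by norm_num)
  have h := abs_eval_one_sub_sub_eval_one_le (p := C M⁻¹ * p) (n := n) (δ := 1 - x)
    ((natDegree_C_mul_le _ _).trans hdeg) (fun y hy => by
      rw [eval_C_mul, abs_mul, abs_of_pos (inv_pos.mpr hM), inv_mul_le_iff₀ hM, mul_one]
      exact hp y hy) (by linarith)
  rw [eval_C_mul, eval_C_mul, ← mul_sub, abs_mul, abs_of_pos (inv_pos.mpr hM), sub_sub_cancel,
    inv_mul_le_iff₀ hM] at h
  refine h.trans ?_
  rw [div_eq_mul_one_div]
  gcongr
  linarith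

/-- If consecutive derivatives `G 0, …, G m` start from a function bounded by `A` on
`[x, x + m k]`, then `G m` is small somewhere on this interval. -/
theorem exists_abs_deriv_mul_pow_le {k : ℝ} (hk : 0 < k) (m : ℕ) (x : ℝ) :
    ∀ (G : ℕ → ℝ → ℝ) (A : ℝ), (∀ i < m, ∀ y, HasDerivAt (G i) (G (i + 1) y) y) →
      (∀ y ∈ Set.Icc x (x + m * k), |G 0 y| ≤ A) →
      ∃ ξ ∈ Set.Icc x (x + m * k), |G m ξ| * k ^ m ≤ 2 ^ m * A := by
  induction m with
  | zero =>
    intro G A _ hA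
    exact ⟨x, by simp, by simpa using hA x (by simp)⟩
  | succ m ih =>
    intro G A hG hA
    push_cast at hA ⊢
    obtain ⟨ξ, hξ, h⟩ := ih (fun i y => G i (y + k) - G i y) (2 * A)
      (fun i hi y => ((hG i (by omega) _).comp_add_const y k).sub (hG i (by omega) y))
      (fun y hy => by
        obtain ⟨h1, h2⟩ := hy
        have e1 := abs_le.mp (hA (y + k) ⟨by linarith, by linarith⟩)
        have e2 := abs_le.mp (hA y ⟨by linarith, by linarith⟩)
        exact abs_le.mpr ⟨by linarith, by linarith⟩)
    obtain ⟨c, hc, hc'⟩ := exists_hasDerivAt_eq_slope (G m) (G (m + 1)) (lt_add_of_pos_right ξ hk)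
      (fun y _ => (hG m (by omega) y).continuousAt.continuousWithinAt)
      (fun y _ => hG m (by omega) y)
    refine ⟨c, ⟨by linarith [hc.1, hξ.1], by linarith [hc.2, hξ.2]⟩, ?_⟩
    rw [add_sub_cancel_left] at hc'
    rw [hc', abs_div, abs_of_pos hk, pow_succ k, pow_succ (2 : ℝ)]
    calc _ = |G m (ξ + k) - G m ξ| * k ^ m := by field_simp
      _ ≤ _ := by linarith

theorem hasDerivAt_Fr (j : ℕ) (x : ℝ) : HasDerivAt (Fr (j + 2)) (Fr (j + 1) x) x := by
  have hcont (i : ℕ) : Continuous (Fr i) := by unfold Fr; fun_prop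
  suffices h : ∀ y ≠ 0, HasDerivAt (Fr (j + 2)) (Fr (j + 1) y) y by
    rcases eq_or_ne x 0 with rfl | hx
    · exact hasDerivAt_of_hasDerivAt_of_ne h (hcont _).continuousAt (hcont _).continuousAt
    · exact h x hx
  intro y hy
  have h := ((hasDerivAt_abs hy).mul (hasDerivAt_pow (j + 1) y)).div_const
    ((j + 2).factorial : ℝ)
  refine h.congr_deriv ?_
  have hsign : (SignType.sign y : ℝ) * y = |y| := sign_mul_self y
  have hne : ((j + 1).factorial : ℝ) ≠ 0 := by positivity
  have hne' : ((j + 2 : ℕ) : ℝ) ≠ 0 := by positivity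
  simp only [Fr, Nat.add_sub_cancel, pow_succ, Nat.factorial_succ (j + 1)]
  push_cast at hne' ⊢
  rw [div_eq_div_iff (by positivity) (by positivity), ← hsign]
  ring

theorem IsTrigPoly.hasDerivAt {n : ℕ} {T : ℝ → ℝ} (hT : IsTrigPoly n T) :
    ∃ S : ℝ → ℝ, IsTrigPoly n S ∧ ∀ x, HasDerivAt T (S x) x := by
  obtain ⟨a, b, h⟩ := hT
  refine ⟨fun t => ∑ k ∈ Finset.Icc 1 n, (a k * (-Real.sin (k * t) * k) +
    b k * (Real.cos (k * t) * k)), ⟨fun k => k * b k, fun k => -(k * a k), fun t => ?_⟩,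
    fun x => ?_⟩
  · simp only [Nat.cast_zero, zero_mul, zero_add]
    exact Finset.sum_congr rfl fun k _ => by ring
  · rw [funext h]
    refine (HasDerivAt.fun_sum fun k _ => ?_).const_add _
    have hk : HasDerivAt (fun t : ℝ => (k : ℝ) * t) k x := by
      simpa using (hasDerivAt_id x).const_mul (k : ℝ)
    exact (hk.cos.const_mul _).add (hk.sin.const_mul _)

theorem IsTrigPoly.deriv {n : ℕ} {T : ℝ → ℝ} (hT : IsTrigPoly n T) : IsTrigPoly n (deriv T) := by
  obtain ⟨S, hS, h⟩ := hT.hasDerivAt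
  rwa [funext fun x => (h x).deriv]

theorem IsTrigPoly.differentiable {n : ℕ} {T : ℝ → ℝ} (hT : IsTrigPoly n T) :
    Differentiable ℝ T := by
  obtain ⟨S, -, h⟩ := hT.hasDerivAt
  exact fun x => (h x).differentiableAt

theorem IsTrigPoly.iteratedDeriv {n : ℕ} {T : ℝ → ℝ} (hT : IsTrigPoly n T) (i : ℕ) :
    IsTrigPoly n (iteratedDeriv i T) := by
  induction i with
  | zero => simpa using hT
  | succ i ih => rw [iteratedDeriv_succ]; exact ih.deriv

theorem IsTrigPoly.hasDerivAt_iteratedDeriv {n : ℕ} {T : ℝ → ℝ} (hT : IsTrigPoly n T) (i : ℕ)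
    (x : ℝ) : HasDerivAt (_root_.iteratedDeriv i T) (_root_.iteratedDeriv (i + 1) T x) x := by
  rw [iteratedDeriv_succ]
  exact ((hT.iteratedDeriv i).differentiable x).hasDerivAt

open Polynomial in
/-- The even part of a trigonometric polynomial is an algebraic polynomial in `cos`. -/
theorem IsTrigPoly.exists_polynomial_even {n : ℕ} {T : ℝ → ℝ} (hT : IsTrigPoly n T) :
    ∃ p : ℝ[X], p.natDegree ≤ n ∧ ∀ t, p.eval (Real.cos t) = T t + T (-t) := by
  obtain ⟨a, b, h⟩ := hT
  refine ⟨C (2 * a 0) + ∑ k ∈ Finset.Icc 1 n, C (2 * a k) * Chebyshev.T ℝ k, ?_, fun t => ?_⟩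
  · refine natDegree_add_le_of_degree_le (by rw [natDegree_C]; exact Nat.zero_le _)
      (natDegree_sum_le_of_forall_le _ _ fun k hk => ?_)
    refine (natDegree_C_mul_le _ _).trans ?_
    rw [Chebyshev.natDegree_T]
    simpa using (Finset.mem_Icc.mp hk).2
  · rw [h, h, add_add_add_comm, ← Finset.sum_add_distrib, eval_add, eval_finsetSum, eval_C]
    congr 1
    · ring
    · refine Finset.sum_congr rfl fun k _ => ?_
      rw [eval_C_mul, Chebyshev.T_real_cos, mul_neg, Real.cos_neg, Real.sin_neg]
      push_cast
      ring

open Polynomial in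
/-- A trigonometric polynomial of degree `n` with minimum at `0` on `[-b/2, b/2]` grows slowly on
a neighbourhood of `0` of size comparable to `b / n`. -/
theorem IsTrigPoly.sub_apply_zero_le {n : ℕ} {V : ℝ → ℝ} (hV : IsTrigPoly n V) (hn : 1 ≤ n)
    {b : ℝ} (hb : 0 < b) (hb' : b ≤ Real.pi) {M : ℝ} (hM : 0 < M)
    (hlow : ∀ t, |t| ≤ b / 2 → V 0 ≤ V t) (hup : ∀ t, |t| ≤ b / 2 → V t - V 0 ≤ M)
    {t : ℝ} (ht : |t| ≤ b / (32 * n)) : V t - V 0 ≤ M / 4 := by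
  obtain ⟨p, hpdeg, hp⟩ := hV.exists_polynomial_even
  have hn' : (1 : ℝ) ≤ n := by exact_mod_cast hn
  have hpi := Real.pi_pos
  have htb : |t| ≤ b / 2 := ht.trans (div_le_div_of_nonneg_left hb.le two_pos (by linarith))
  set s := (1 - Real.cos (b / 2)) / 2 with hs
  have hsb : b ^ 2 ≤ 64 * s := by
    have h := Real.cos_le_one_sub_mul_cos_sq (x := b / 2)
      (by rw [abs_of_pos (by linarith)]; linarith)
    have h2 : 2 / 4 ^ 2 * (b / 2) ^ 2 ≤ 2 / Real.pi ^ 2 * (b / 2) ^ 2 := by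
      gcongr
      exact Real.pi_le_four
    rw [hs]
    linarith
  have hs0 : 0 < s := by nlinarith
  set q : ℝ[X] := p.comp (C (1 - s) + C s * X) - C (2 * V 0) with hq
  have hqeval (x : ℝ) : q.eval x = p.eval (1 - s + s * x) - 2 * V 0 := by
    simp only [hq, eval_sub, eval_comp, eval_add, eval_mul, eval_C, eval_X]
  have hqdeg : q.natDegree ≤ n := by
    refine natDegree_sub_le_of_le (natDegree_comp_le.trans ?_) (natDegree_C _).le |>.trans
      (by simp : max n 0 ≤ n)
    have h1 : (C (1 - s) + C s * X : ℝ[X]).natDegree ≤ 1 := by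
      rw [add_comm]
      exact natDegree_linear_le
    exact (Nat.mul_le_mul hpdeg h1).trans (by simp)
  have hbound : ∀ x ∈ Set.Icc (-1 : ℝ) 1, |q.eval x| ≤ 2 * M := by
    intro x hx
    have hx1 : Real.cos (b / 2) ≤ 1 - s + s * x := by
      have : 0 ≤ s * (1 + x) := mul_nonneg hs0.le (by linarith [hx.1])
      linarith
    have hx2 : 1 - s + s * x ≤ 1 := by
      have : 0 ≤ s * (1 - x) := mul_nonneg hs0.le (by linarith [hx.2])
      linarith
    have hcos := Real.cos_arccos (by linarith [Real.neg_one_le_cos (b / 2)]) hx2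
    have hle : |Real.arccos (1 - s + s * x)| ≤ b / 2 := by
      rw [abs_of_nonneg (Real.arccos_nonneg _), ← Real.arccos_cos (x := b / 2)
        (by linarith) (by linarith)]
      exact Real.arccos_le_arccos hx1
    rw [hqeval, ← hcos, hp]
    have h1 := hlow _ hle
    have h2 := hup _ hle
    rw [← abs_neg] at hle
    have h3 := hlow _ hle
    have h4 := hup _ hle
    exact abs_le.mpr ⟨by linarith, by linarith⟩
  have ht2 : 1 - Real.cos t ≤ b ^ 2 / (2048 * n ^ 2) := by
    have h1 := Real.one_sub_sq_div_two_le_cos (x := t)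
    have h2 : t ^ 2 ≤ (b / (32 * n)) ^ 2 := sq_le_sq.mpr (ht.trans (le_abs_self _))
    have h3 : (b / (32 * n)) ^ 2 / 2 = b ^ 2 / (2048 * n ^ 2) := by field_simp; norm_num
    linarith
  have h := abs_eval_sub_eval_one_le hqdeg (by positivity : 0 < 2 * M) hbound
    (x := 1 - (1 - Real.cos t) / s)
    (by have := div_nonneg (sub_nonneg.mpr (Real.cos_le_one t)) hs0.le; linarith) (by
      rw [sub_sub_cancel, mul_div_assoc', div_le_one hs0]
      have : 32 * (n : ℝ) ^ 2 * (1 - Real.cos t) ≤ 32 * n ^ 2 * (b ^ 2 / (2048 * n ^ 2)) := by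
        gcongr
      have h2 : 32 * (n : ℝ) ^ 2 * (b ^ 2 / (2048 * n ^ 2)) = b ^ 2 / 64 := by
        field_simp; norm_num
      linarith)
  have e1 : 1 - s + s * (1 - (1 - Real.cos t) / s) = Real.cos t := by field_simp; ring
  have e2 : 1 - s + s * 1 = Real.cos 0 := by rw [Real.cos_zero]; ring
  rw [hqeval, hqeval, e1, e2, hp, hp, neg_zero] at h
  have h1 := (abs_le.mp h).2
  have h2 := hlow (-t) (by rwa [abs_neg])
  linarith

theorem image_sub_le_of_hasDerivAt_le {f f' : ℝ → ℝ} (hf : ∀ x, HasDerivAt f (f' x) x)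
    {x y K : ℝ} (hxy : x ≤ y) (hK : ∀ z ∈ Set.Icc x y, f' z ≤ K) : f y - f x ≤ K * (y - x) :=
  (convex_Icc x y).image_sub_le_mul_sub_of_deriv_le
    (fun z _ => (hf z).continuousAt.continuousWithinAt)
    (fun z _ => (hf z).differentiableAt.differentiableWithinAt)
    (fun z hz => by rw [(hf z).deriv]; exact hK z (interior_subset hz))
    x (Set.left_mem_Icc.mpr hxy) y (Set.right_mem_Icc.mpr hxy) hxy

theorem le_image_sub_of_le_hasDerivAt {f f' : ℝ → ℝ} (hf : ∀ x, HasDerivAt f (f' x) x)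
    {x y K : ℝ} (hxy : x ≤ y) (hK : ∀ z ∈ Set.Icc x y, K ≤ f' z) : K * (y - x) ≤ f y - f x :=
  (convex_Icc x y).mul_sub_le_image_sub_of_le_deriv
    (fun z _ => (hf z).continuousAt.continuousWithinAt)
    (fun z _ => (hf z).differentiableAt.differentiableWithinAt)
    (fun z hz => by rw [(hf z).deriv]; exact hK z (interior_subset hz))
    x (Set.left_mem_Icc.mpr hxy) y (Set.right_mem_Icc.mpr hxy) hxy

/-- If the derivative `V` of `W` is a trigonometric polynomial that decreases on `[-b, 0]` and
increases on `[0, b]`, then the increments of `W` over intervals of length `b / 4` cannot be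
closer than order `b / n` to those of `|x| + c x`. -/
theorem IsTrigPoly.div_le_of_increment_le {n : ℕ} {V W : ℝ → ℝ} (hV : IsTrigPoly n V)
    (hn : 1 ≤ n) {b : ℝ} (hb : 0 < b) (hb' : b ≤ Real.pi) (hW : ∀ x, HasDerivAt W (V x) x)
    (hanti : AntitoneOn V (Set.Icc (-b) 0)) (hmono : MonotoneOn V (Set.Icc 0 b)) {c B : ℝ}
    (H : ∀ x ∈ Set.Icc (-b) (5 * b / 8), ∃ ξ ∈ Set.Icc x (x + b / 8),
      |(|ξ + b / 4| + c * (ξ + b / 4) - W (ξ + b / 4)) - (|ξ| + c * ξ - W ξ)| ≤ B) :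
    b / (32 * n) ≤ 2 * B := by
  have hn' : (1 : ℝ) ≤ n := by exact_mod_cast hn
  set τ := b / (32 * n) with hτ
  have hτ0 : 0 < τ := by positivity
  have hτb : τ ≤ b / 32 := div_le_div_of_nonneg_left hb.le (by norm_num) (by linarith)
  by_contra! hB
  set e := 4 * B / b with he
  have heB : e * (b / 4) = B := by rw [he]; field_simp
  have he2 : e < 1 / 2 := by rw [he, div_lt_iff₀ hb]; linarith
  have hright : ∀ y ∈ Set.Icc 0 (b / 2), V y ≤ 1 + c + e := by
    intro y hy
    obtain ⟨ξ, hξ, h⟩ := H (b / 2) ⟨by linarith, by linarith⟩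
    obtain ⟨h1, h2⟩ := hξ
    have h3 := le_image_sub_of_le_hasDerivAt hW (K := V y) (x := ξ) (y := ξ + b / 4)
      (by linarith) (fun z hz => hmono ⟨hy.1, by linarith [hy.2]⟩
        ⟨by linarith [hz.1], by linarith [hz.2]⟩ (by linarith [hy.2, hz.1]))
    rw [abs_of_nonneg (by linarith : 0 ≤ ξ), abs_of_nonneg (by linarith : 0 ≤ ξ + b / 4)] at h
    have h4 := (abs_le.mp h).1
    nlinarith
  have hleft : ∀ y ∈ Set.Icc (-(b / 2)) 0, V y ≤ -1 + c + e := by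
    intro y hy
    obtain ⟨ξ, hξ, h⟩ := H (-b) ⟨by linarith, by linarith⟩
    obtain ⟨h1, h2⟩ := hξ
    have h3 := le_image_sub_of_le_hasDerivAt hW (K := V y) (x := ξ) (y := ξ + b / 4)
      (by linarith) (fun z hz => hanti ⟨by linarith [hz.1], by linarith [hz.2]⟩
        ⟨by linarith [hy.1], hy.2⟩ (by linarith [hy.1, hz.2]))
    rw [abs_of_nonpos (by linarith : ξ ≤ 0), abs_of_nonpos (by linarith : ξ + b / 4 ≤ 0)] at h
    have h4 := (abs_le.mp h).1
    nlinarith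
  have hd : V 0 - c ≤ -1 / 2 := by linarith [hleft 0 ⟨by linarith, le_rfl⟩]
  have hmid : ∀ y ∈ Set.Icc 0 τ, V y ≤ c := by
    intro y hy
    have h := hV.sub_apply_zero_le hn hb hb' (M := 4 * (c - V 0)) (by linarith)
      (fun t ht => by
        obtain ⟨h1, h2⟩ := abs_le.mp ht
        rcases le_total t 0 with h0 | h0
        · exact hanti ⟨by linarith, h0⟩ ⟨by linarith, le_rfl⟩ h0
        · exact hmono ⟨le_rfl, by linarith⟩ ⟨h0, by linarith⟩ h0)
      (fun t ht => by
        obtain ⟨h1, h2⟩ := abs_le.mp ht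
        rcases le_total t 0 with h0 | h0
        · linarith [hleft t ⟨h1, h0⟩]
        · linarith [hright t ⟨h0, h2⟩])
      (t := y) (by rw [abs_of_nonneg hy.1]; exact hy.2)
    linarith
  obtain ⟨ξ, hξ, h⟩ := H (-(3 * b / 16)) ⟨by linarith, by linarith⟩
  obtain ⟨h1, h2⟩ := hξ
  rw [abs_of_nonpos (by linarith : ξ ≤ 0), abs_of_nonneg (by linarith : 0 ≤ ξ + b / 4)] at h
  have h3 := image_sub_le_of_hasDerivAt_le hW (x := ξ) (y := 0) (by linarith)
    (fun z hz => hleft z ⟨by linarith [hz.1], hz.2⟩)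
  have h4 := image_sub_le_of_hasDerivAt_le hW (x := 0) (y := τ) hτ0.le hmid
  have h5 := image_sub_le_of_hasDerivAt_le hW (x := τ) (y := ξ + b / 4) (by linarith)
    (fun z hz => hright z ⟨by linarith [hz.1], by linarith [hz.2]⟩)
  have h6 := (abs_le.mp h).2
  have hB0 : 0 ≤ B := (abs_nonneg _).trans h
  have he0 : 0 ≤ e * τ := by rw [he]; positivity
  nlinarith

/-- The successive derivatives of `F_{r+1} + P - T` up to order `r`. -/
theorem exists_hasDerivAt_family_Fr_sub {n r : ℕ} {T : ℝ → ℝ} (hT : IsTrigPoly n T)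
    {P : Polynomial ℝ} (hP : P.degree ≤ r + 1) :
    ∃ (G : ℕ → ℝ → ℝ) (c d : ℝ), (∀ i < r, ∀ y, HasDerivAt (G i) (G (i + 1) y) y) ∧
      (∀ y, G 0 y = Fr (r + 1) y + P.eval y - T y) ∧
      ∀ y, G r y = |y| + c * y + d - iteratedDeriv r T y := by
  have hdeg : (Polynomial.derivative^[r] P).natDegree ≤ 1 := by
    have h1 := Polynomial.natDegree_iterate_derivative P r
    have h2 : P.natDegree ≤ r + 1 := Polynomial.natDegree_le_of_degree_le (by exact_mod_cast hP)
    omega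
  obtain ⟨c, d, hcd⟩ := Polynomial.exists_eq_X_add_C_of_natDegree_le_one hdeg
  refine ⟨fun i y => Fr (r + 1 - i) y + (Polynomial.derivative^[i] P).eval y -
    iteratedDeriv i T y, c, d, fun i hi y => ?_, fun y => by simp, fun y => ?_⟩
  · refine (HasDerivAt.add ?_ ?_).sub (hT.hasDerivAt_iteratedDeriv i y)
    · obtain ⟨j, rfl⟩ := Nat.exists_eq_add_of_lt hi
      rw [show i + j + 1 + 1 - i = j + 2 by omega, show i + j + 1 + 1 - (i + 1) = j + 1 by omega]
      exact hasDerivAt_Fr j y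
    · rw [Function.iterate_succ_apply']
      exact Polynomial.hasDerivAt _ y
  · simp only [hcd, Nat.add_sub_cancel_left, Fr]
    simp
    ring

/-- **Lemma 4.2.** For each `r ∈ ℕ` there is `c₃ = c₃(r) > 0` such that for every `b ∈ (0, π]`,
every trigonometric polynomial `T` of degree at most `n` with `t T^{(r+1)}(t) ≥ 0` for `|t| ≤ b`,
and every algebraic polynomial `P` of degree at most `r`,
`n max_{|x| ≤ b} |F_r(x) + P(x) - T(x)| ≥ c₃ b^r`. -/
theorem trig_approx_Fr_lower_bound (r : ℕ) (hr : 1 ≤ r) :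
    ∃ c₃ : ℝ, 0 < c₃ ∧ ∀ b : ℝ, b ∈ Set.Ioc 0 Real.pi → ∀ n : ℕ, 1 ≤ n →
      ∀ T : ℝ → ℝ, IsTrigPoly n T →
        (∀ t : ℝ, |t| ≤ b → 0 ≤ t * iteratedDeriv (r + 1) T t) →
      ∀ P : Polynomial ℝ, P.degree ≤ (r : ℕ) →
        c₃ * b ^ r ≤
          n * sSup ((fun x => |Fr r x + P.eval x - T x|) '' Set.Icc (-b) b) := by
  obtain ⟨m, rfl⟩ := Nat.exists_eq_add_of_le' hr
  refine ⟨(32 * (2 ^ (m + 2) * (8 * (m + 1)) ^ m))⁻¹, by positivity, ?_⟩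
  intro b hb n hn T hT hsign P hP
  obtain ⟨hb0, hbpi⟩ := hb
  have hn' : (1 : ℝ) ≤ n := by exact_mod_cast hn
  set E := sSup ((fun x => |Fr (m + 1) x + P.eval x - T x|) '' Set.Icc (-b) b) with hE
  have hle : ∀ y ∈ Set.Icc (-b) b, |Fr (m + 1) y + P.eval y - T y| ≤ E := by
    intro y hy
    have hF : Continuous (Fr (m + 1)) := by unfold Fr; fun_prop
    have hcont : Continuous fun x => |Fr (m + 1) x + P.eval x - T x| :=
      ((hF.add P.continuous).sub hT.differentiable.continuous).abs
    exact le_csSup (isCompact_Icc.image hcont).bddAbove (Set.mem_image_of_mem _ hy)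
  obtain ⟨G, c, d, hG, hG0, hGm⟩ :=
    exists_hasDerivAt_family_Fr_sub hT (r := m) (by exact_mod_cast hP)
  have hderiv := hT.hasDerivAt_iteratedDeriv (m + 1)
  have hcontV (s : Set ℝ) : ContinuousOn (iteratedDeriv (m + 1) T) s :=
    fun x _ => (hderiv x).continuousAt.continuousWithinAt
  set k := b / (8 * (m + 1)) with hk
  have hk0 : 0 < k := by positivity
  have hmk : m * k ≤ b / 8 := by
    have : (m + 1) * k = b / 8 := by rw [hk]; field_simp
    linarith
  have key := (hT.iteratedDeriv (m + 1)).div_le_of_increment_le hn hb0 hbpi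
    (W := iteratedDeriv m T) (c := c) (B := 2 ^ m * (2 * E) / k ^ m)
    (hT.hasDerivAt_iteratedDeriv m)
    (antitoneOn_of_deriv_nonpos (convex_Icc _ _) (hcontV _)
      (fun x _ => (hderiv x).differentiableAt.differentiableWithinAt) (fun x hx => by
        rw [interior_Icc] at hx
        rw [(hderiv x).deriv]
        have := hsign x (abs_le.mpr ⟨hx.1.le, by linarith [hx.2]⟩)
        exact nonpos_of_mul_nonneg_right this hx.2))
    (monotoneOn_of_deriv_nonneg (convex_Icc _ _) (hcontV _)
      (fun x _ => (hderiv x).differentiableAt.differentiableWithinAt) (fun x hx => by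
        rw [interior_Icc] at hx
        rw [(hderiv x).deriv]
        have := hsign x (abs_le.mpr ⟨by linarith [hx.1], hx.2.le⟩)
        exact nonneg_of_mul_nonneg_right this hx.1))
    (fun x hx => by
      obtain ⟨hx1, hx2⟩ := hx
      obtain ⟨ξ, hξ, h⟩ := exists_abs_deriv_mul_pow_le hk0 m x
        (fun i y => G i (y + b / 4) - G i y) (2 * E)
        (fun i hi y => ((hG i hi _).comp_add_const y (b / 4)).sub (hG i hi y))
        (fun y hy => by
          obtain ⟨hy1, hy2⟩ := hy
          have e1 := abs_le.mp (hle (y + b / 4) ⟨by linarith, by linarith⟩)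
          have e2 := abs_le.mp (hle y ⟨by linarith, by linarith⟩)
          rw [← hG0] at e1 e2
          exact abs_le.mpr ⟨by linarith, by linarith⟩)
      refine ⟨ξ, ⟨hξ.1, by linarith [hξ.2]⟩, ?_⟩
      rw [le_div_iff₀ (pow_pos hk0 m)]
      refine le_of_eq_of_le ?_ h
      rw [hGm, hGm]
      congr 2
      ring)
  have e : 2 * (2 ^ m * (2 * E) / k ^ m) = 2 ^ (m + 2) * (8 * (m + 1)) ^ m * E / b ^ m := by
    rw [hk, div_pow]
    field_simp
    ring
  rw [e, div_le_div_iff₀ (by positivity) (by positivity)] at key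
  rw [inv_mul_le_iff₀ (by positivity), pow_succ]
  linarith
end
end

section
/- For each b ∈ (0, π] and each r ∈ ℕ there exists a 2π-periodic function E of class C^{r−1} on ℝ such that: (1) ∫_{−π}^{π} E(x) dx = 0; (2) the r-th derivative of E satisfies E^{(r)}(x) = sign(x) − (1 − b/π) for all x ∈ (−b, 2π−b) ∖ {0}; (3) there is an algebraic polynomial p of degree ≤ r with E(x) = F_r(x) + p(x) for all x ∈ [−b, 2π−b]; and (4) esssup_{x∈ℝ} |E^{(r)}(x)| < 2, so that E belongs to the Sobolev class W^r of 2π-periodic functions with (r−1)-st derivative absolutely continuous and r-th derivative essentially bounded by 2. -/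
noncomputable section

/-- Every real polynomial has a polynomial antiderivative of degree at most one more. -/
theorem exists_polynomial_antiderivative (n : ℕ) (p : Polynomial ℝ) (hp : p.degree ≤ (n : ℕ)) :
    ∃ q : Polynomial ℝ, q.degree ≤ (n + 1 : ℕ) ∧ q.derivative = p := by
  refine ⟨∑ i ∈ Finset.range (n + 1),
    Polynomial.C (p.coeff i / (i + 1)) * Polynomial.X ^ (i + 1), ?_, ?_⟩
  · refine (Polynomial.degree_sum_le _ _).trans (Finset.sup_le fun i hi => ?_)
    refine (Polynomial.degree_C_mul_X_pow_le _ _).trans ?_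
    have := Finset.mem_range.1 hi
    exact_mod_cast (by omega : i + 1 ≤ n + 1)
  · conv_rhs => rw [p.as_sum_range_C_mul_X_pow' (n := n + 1)
      (Nat.lt_succ_of_le (Polynomial.natDegree_le_of_degree_le hp))]
    rw [Polynomial.derivative_sum]
    refine Finset.sum_congr rfl fun i _ => ?_
    rw [Polynomial.derivative_C_mul_X_pow]
    have h : (i : ℝ) + 1 ≠ 0 := by positivity
    congr 2
    push_cast
    field_simp

theorem continuous_Fr (r : ℕ) : Continuous (Fr r) := by
  unfold Fr
  fun_prop

theorem hasDerivAt_Fr_succ (n : ℕ) (x : ℝ) :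
    HasDerivAt (Fr (n + 2)) (Fr (n + 1) x) x := by
  have key : ∀ y : ℝ, y ≠ 0 → HasDerivAt (Fr (n + 2)) (Fr (n + 1) y) y := by
    intro y hy
    have h := ((hasDerivAt_abs hy).mul (hasDerivAt_pow (n + 1) y)).div_const
      ((n + 2).factorial : ℝ)
    refine h.congr_deriv ?_
    have hs : (SignType.sign y : ℝ) * y = |y| := sign_mul_self y
    have hf : ((n + 1).factorial : ℝ) ≠ 0 := by positivity
    have hn : ((n : ℝ) + 2) ≠ 0 := by positivity
    simp only [Fr, Nat.factorial_succ (n + 1), Nat.add_sub_cancel]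
    push_cast
    rw [pow_succ, ← hs]
    field_simp
    ring
  rcases eq_or_ne x 0 with rfl | hx
  · exact hasDerivAt_of_hasDerivAt_of_ne key (continuous_Fr _).continuousAt
      (continuous_Fr _).continuousAt
  · exact key x hx

theorem real_sign_monotone : Monotone Real.sign := by
  intro x y hxy
  rcases lt_trichotomy x 0 with hx | rfl | hx
  · rw [Real.sign_of_neg hx]
    rcases Real.sign_apply_eq y with h | h | h <;> rw [h] <;> norm_num
  · rcases hxy.eq_or_lt with rfl | h
    · rfl
    · rw [Real.sign_of_pos h, Real.sign_zero]; norm_num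
  · rw [Real.sign_of_pos hx, Real.sign_of_pos (hx.trans_le hxy)]

/-- The mean-zero primitive of a mean-zero `T`-periodic function, compared on one period around
`0` with any given primitive `G` on that period. -/
theorem exists_periodic_primitive {T a : ℝ} (hT : 0 < T) (ha : (0 : ℝ) ∈ Set.Icc a (a + T))
    {g G : ℝ → ℝ} (hg : Function.Periodic g T)
    (hint : ∀ u v : ℝ, IntervalIntegrable g MeasureTheory.volume u v)
    (hzero : ∫ x in a..(a + T), g x = 0) (hG : Continuous G)
    (hGg : ∀ x ∈ Set.Ioo a (a + T), x ≠ 0 → HasDerivAt G (g x) x) :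
    ∃ (E : ℝ → ℝ) (c : ℝ), Function.Periodic E T ∧ Continuous E ∧
      (∀ x, E x = c + ∫ t in (0 : ℝ)..x, g t) ∧ (∀ s, ∫ x in s..(s + T), E x = 0) ∧
      ∀ x ∈ Set.Icc a (a + T), E x = G x + (c - G 0) := by
  set H : ℝ → ℝ := fun x => ∫ t in (0 : ℝ)..x, g t with hH
  have hHc : Continuous H := intervalIntegral.continuous_primitive hint 0
  have hHp : Function.Periodic H T := by
    intro x
    have h := intervalIntegral.integral_add_adjacent_intervals (hint 0 x) (hint x (x + T))
    rw [hg.intervalIntegral_add_eq x a, hzero, add_zero] at h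
    exact h.symm
  set c : ℝ := -(∫ x in (0 : ℝ)..(0 + T), H x) / T with hc
  have hEp : Function.Periodic (fun x => c + H x) T := fun x => by simp only [hHp x]
  refine ⟨fun x => c + H x, c, hEp, by fun_prop, fun x => rfl, fun s => ?_, fun x hx => ?_⟩
  · rw [hEp.intervalIntegral_add_eq s 0,
      intervalIntegral.integral_add (by simp) (hHc.intervalIntegrable _ _),
      intervalIntegral.integral_const, hc]
    simp only [smul_eq_mul]
    field_simp
    ring
  · have h := MeasureTheory.integral_eq_of_hasDerivAt_off_countable G g (a := 0) (b := x)
      (Set.countable_singleton (0 : ℝ)) hG.continuousOn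
      (fun y hy => hGg y ⟨(le_min ha.1 hx.1).trans_lt hy.1.1,
        hy.1.2.trans_le (max_le ha.2 hx.2)⟩ hy.2) (hint 0 x)
    simp only [hH, h]
    ring

/-- The `2π`-periodic function equal to `sign x - (1 - b / π)` on `[-b, 2π - b)`. -/
def eulerianStep (b x : ℝ) : ℝ :=
  Real.sign (toIcoMod Real.two_pi_pos (-b) x) - (1 - b / Real.pi)

theorem eulerianStep_periodic (b : ℝ) : Function.Periodic (eulerianStep b) (2 * Real.pi) :=
  fun x => by simp only [eulerianStep, toIcoMod_add_right]

theorem eulerianStep_eq {b x : ℝ} (hx : x ∈ Set.Ioo (-b) (-b + 2 * Real.pi)) :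
    eulerianStep b x = Real.sign x - (1 - b / Real.pi) := by
  rw [eulerianStep, (toIcoMod_eq_self _).2 ⟨hx.1.le, hx.2⟩]

theorem eulerianStep_intervalIntegrable (b u v : ℝ) :
    IntervalIntegrable (eulerianStep b) MeasureTheory.volume u v := by
  refine (eulerianStep_periodic b).intervalIntegrable Real.two_pi_pos.ne' (t := -b) ?_ u v
  have h : IntervalIntegrable (fun x => Real.sign x - (1 - b / Real.pi)) MeasureTheory.volume
      (-b) (-b + 2 * Real.pi) :=
    real_sign_monotone.intervalIntegrable.sub (by simp)
  refine h.congr_uIoo fun x hx => ?_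
  rw [Set.uIoo_of_le (by linarith [Real.pi_pos])] at hx
  exact (eulerianStep_eq hx).symm

theorem abs_eulerianStep_le {b : ℝ} (hb : b ∈ Set.Ioc 0 Real.pi) (x : ℝ) :
    |eulerianStep b x| ≤ 2 - b / Real.pi := by
  have h0 : 0 < b / Real.pi := div_pos hb.1 Real.pi_pos
  have h1 : b / Real.pi ≤ 1 := (div_le_one Real.pi_pos).2 hb.2
  rw [eulerianStep, abs_le]
  rcases Real.sign_apply_eq (toIcoMod Real.two_pi_pos (-b) x) with h | h | h <;> rw [h] <;>
    constructor <;> linarith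

theorem hasDerivAt_abs_sub_mul {b x : ℝ} (hx : x ∈ Set.Ioo (-b) (-b + 2 * Real.pi))
    (hx0 : x ≠ 0) :
    HasDerivAt (fun y => |y| - (1 - b / Real.pi) * y) (eulerianStep b x) x := by
  rw [eulerianStep_eq hx]
  refine ((hasDerivAt_abs hx0).sub ((hasDerivAt_id x).const_mul (1 - b / Real.pi))).congr_deriv ?_
  rcases hx0.lt_or_gt with h | h
  · simp [Real.sign_of_neg h, h]
  · simp [Real.sign_of_pos h, h]

theorem integral_eulerianStep {b : ℝ} (hb : b ∈ Set.Ioc 0 Real.pi) :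
    ∫ x in (-b)..(-b + 2 * Real.pi), eulerianStep b x = 0 := by
  have hpi := Real.pi_pos
  have hb1 := hb.1
  have hb2 := hb.2
  have hle : -b ≤ -b + 2 * Real.pi := by linarith
  rw [MeasureTheory.integral_eq_of_hasDerivAt_off_countable
    (fun y => |y| - (1 - b / Real.pi) * y) (eulerianStep b) (Set.countable_singleton (0 : ℝ))
    (by fun_prop) (fun x hx => hasDerivAt_abs_sub_mul (by
      rw [min_eq_left hle, max_eq_right hle] at hx; exact hx.1) hx.2)
    (eulerianStep_intervalIntegrable b _ _)]
  simp only [abs_neg, abs_of_pos hb1, abs_of_nonneg (by linarith : 0 ≤ -b + 2 * Real.pi)]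
  field_simp
  ring

/-- The mean-zero `n`-th periodic primitive of the continuous mean-zero periodic primitive of
`eulerianStep b`. -/
theorem exists_iterated_primitive_eulerianStep {b : ℝ} (hb : b ∈ Set.Ioc 0 Real.pi) (n : ℕ) :
    ∃ E : ℝ → ℝ, Function.Periodic E (2 * Real.pi) ∧ ContDiff ℝ n E ∧
      (∀ s, ∫ x in s..(s + 2 * Real.pi), E x = 0) ∧
      (∃ c k : ℝ, (∀ x, iteratedDeriv n E x = c + ∫ t in (0 : ℝ)..x, eulerianStep b t) ∧
        ∀ x ∈ Set.Icc (-b) (-b + 2 * Real.pi),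
          iteratedDeriv n E x = |x| - (1 - b / Real.pi) * x + k) ∧
      ∃ p : Polynomial ℝ, p.degree ≤ (n + 1 : ℕ) ∧
        ∀ x ∈ Set.Icc (-b) (-b + 2 * Real.pi), E x = Fr (n + 1) x + p.eval x := by
  have ha : (0 : ℝ) ∈ Set.Icc (-b) (-b + 2 * Real.pi) :=
    ⟨by linarith [hb.1], by linarith [hb.2, Real.pi_pos]⟩
  induction n with
  | zero =>
    obtain ⟨E, c, hEp, hEc, hE, hE0, hEG⟩ := exists_periodic_primitive Real.two_pi_pos ha
      (eulerianStep_periodic b) (eulerianStep_intervalIntegrable b) (integral_eulerianStep hb)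
      (by fun_prop) (fun x hx hx0 => hasDerivAt_abs_sub_mul hx hx0)
    refine ⟨E, hEp, by simpa using hEc, hE0, ⟨c, _, by simpa using hE, by
      simpa only [iteratedDeriv_zero] using hEG⟩, ?_⟩
    refine ⟨Polynomial.C (-(1 - b / Real.pi)) * Polynomial.X + Polynomial.C c, ?_, fun x hx => ?_⟩
    · exact Polynomial.degree_linear_le
    · rw [hEG x hx]
      simp [Fr]
      ring
  | succ n ih =>
    obtain ⟨e, hep, hec, he0, ⟨c, k, hc, hk⟩, p, hp, hpe⟩ := ih
    obtain ⟨q, hq, hqp⟩ := exists_polynomial_antiderivative (n + 1) p hp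
    have hcont : Continuous e := hec.continuous
    obtain ⟨E, d, hEp, hEc, hE, hE0, hEG⟩ := exists_periodic_primitive Real.two_pi_pos ha
      (G := fun x => Fr (n + 2) x + q.eval x) hep (fun u v => hcont.intervalIntegrable u v)
      (he0 (-b)) ((continuous_Fr _).add q.continuous) (fun x hx _ => by
        rw [hpe x ⟨hx.1.le, hx.2.le⟩, ← hqp]
        exact (hasDerivAt_Fr_succ n x).add (q.hasDerivAt x))
    have hderiv : ∀ x, HasDerivAt E (e x) x := fun x => by
      rw [funext hE]
      exact (hcont.integral_hasStrictDerivAt 0 x).hasDerivAt.const_add d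
    have hd : deriv E = e := funext fun x => (hderiv x).deriv
    refine ⟨E, hEp, ?_, hE0, ⟨c, k, ?_, ?_⟩, ?_⟩
    · push_cast
      refine contDiff_succ_iff_deriv.2 ⟨fun x => (hderiv x).differentiableAt, by simp, ?_⟩
      rwa [hd]
    · rwa [iteratedDeriv_succ', hd]
    · rwa [iteratedDeriv_succ', hd]
    · refine ⟨q + Polynomial.C (d - (Fr (n + 2) 0 + q.eval 0)), ?_, fun x hx => ?_⟩
      · refine (Polynomial.degree_add_le _ _).trans (max_le hq ?_)
        exact Polynomial.degree_C_le.trans (by exact_mod_cast Nat.zero_le _)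
      · rw [hEG x hx, Polynomial.eval_add, Polynomial.eval_C]
        ring

/-- **Definition 2.1 and properties (2.2)-(2.4).** For each `b ∈ (0, π]` and `r ∈ ℕ` there is a
`2π`-periodic function `E ∈ C^{r-1}(ℝ)` (an Eulerian-type ideal spline) such that:
(1) `∫_{-π}^{π} E = 0`;
(2) `E^{(r)}(x) = sign x - (1 - b/π)` for `x ∈ (-b, 2π - b) \ {0}`;
(3) `E = F_r + p` on `[-b, 2π - b]` for some algebraic polynomial `p` of degree at most `r`;
(4) `E^{(r-1)}` is absolutely continuous with `esssup |E^{(r)}| < 2`, so `E ∈ W^r`. -/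
theorem exists_eulerian_type_spline (b : ℝ) (hb : b ∈ Set.Ioc 0 Real.pi) (r : ℕ)
    (hr : 1 ≤ r) :
    ∃ E : ℝ → ℝ,
      (∀ x : ℝ, E (x + 2 * Real.pi) = E x) ∧
      ContDiff ℝ (r - 1 : ℕ) E ∧
      (∫ x in (-Real.pi)..Real.pi, E x) = 0 ∧
      (∀ x ∈ Set.Ioo (-b) (2 * Real.pi - b), x ≠ 0 →
        HasDerivAt (iteratedDeriv (r - 1) E) (Real.sign x - (1 - b / Real.pi)) x) ∧
      (∃ p : Polynomial ℝ, p.degree ≤ (r : ℕ) ∧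
        ∀ x ∈ Set.Icc (-b) (2 * Real.pi - b), E x = Fr r x + p.eval x) ∧
      (∃ g : ℝ → ℝ,
        (∀ a c : ℝ, IntervalIntegrable g MeasureTheory.volume a c) ∧
        (∃ M : ℝ, M < 2 ∧ ∀ᵐ x ∂MeasureTheory.volume, |g x| ≤ M) ∧
        ∀ x : ℝ, iteratedDeriv (r - 1) E x =
          iteratedDeriv (r - 1) E 0 + ∫ t in (0 : ℝ)..x, g t) := by
  obtain ⟨n, rfl⟩ : ∃ n, r = n + 1 := ⟨r - 1, by omega⟩
  have hI : 2 * Real.pi - b = -b + 2 * Real.pi := by ring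
  obtain ⟨E, hEp, hEc, hE0, ⟨c, k, hc, hk⟩, p, hp, hpE⟩ :=
    exists_iterated_primitive_eulerianStep hb n
  rw [hI, Nat.add_sub_cancel]
  refine ⟨E, hEp, hEc, ?_, fun x hx hx0 => ?_, ⟨p, hp, hpE⟩, eulerianStep b,
    eulerianStep_intervalIntegrable b,
    ⟨2 - b / Real.pi, by linarith [div_pos hb.1 Real.pi_pos],
      Filter.Eventually.of_forall (abs_eulerianStep_le hb)⟩, fun x => ?_⟩
  · have h := hE0 (-Real.pi)
    rwa [show -Real.pi + 2 * Real.pi = Real.pi by ring] at h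
  · rw [← eulerianStep_eq hx]
    refine ((hasDerivAt_abs_sub_mul hx hx0).add_const k).congr_of_eventuallyEq ?_
    filter_upwards [Ioo_mem_nhds hx.1 hx.2] with y hy using hk y ⟨hy.1.le, hy.2.le⟩
  · rw [hc x, hc 0, intervalIntegral.integral_same, add_zero]
end
end

section
/- For each integer q ≥ 3 there exists a constant c > 0 (depending only on q) such that for every b > 0 and every function g : [−b, b] → ℝ that is (q−2)-times continuously differentiable with g^{(q−2)} convex on [0, b] and g^{(q−2)} concave on [−b, 0], one has max_{x∈[−b,b]} | F_{q−2}(x) − g(x) | ≥ c · b^{q−2}. -/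
noncomputable section

/-- If the `r`-th derivative of a function is at least `m` on `[0, r t]` and the function is bounded
by `δ` there, then `m t ^ r ≤ 2 ^ r δ`. The derivatives are given as the family `f`. -/
theorem mul_pow_le_two_pow_mul_of_le_deriv (r : ℕ) {t : ℝ} (ht : 0 ≤ t) (f : ℕ → ℝ → ℝ) (m δ : ℝ)
    (hf : ∀ i < r, ∀ x ∈ Set.Icc 0 (r * t),
      HasDerivWithinAt (f i) (f (i + 1) x) (Set.Icc 0 (r * t)) x)
    (hm : ∀ x ∈ Set.Icc 0 (r * t), m ≤ f r x)
    (hδ : ∀ x ∈ Set.Icc 0 (r * t), |f 0 x| ≤ δ) :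
    m * t ^ r ≤ 2 ^ r * δ := by
  induction r generalizing f m δ with
  | zero =>
    have h0 : (0 : ℝ) ∈ Set.Icc 0 (((0 : ℕ) : ℝ) * t) := by simp
    have h := (hm 0 h0).trans ((le_abs_self _).trans (hδ 0 h0))
    simpa using h
  | succ r ih =>
    have hcast : ((r + 1 : ℕ) : ℝ) * t = r * t + t := by push_cast; ring
    have mem_left : ∀ x ∈ Set.Icc 0 (r * t), x ∈ Set.Icc 0 (((r + 1 : ℕ) : ℝ) * t) := by
      rintro x ⟨h0, h1⟩
      exact ⟨h0, by linarith⟩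
    have mem_right : ∀ x ∈ Set.Icc 0 (r * t), x + t ∈ Set.Icc 0 (((r + 1 : ℕ) : ℝ) * t) := by
      rintro x ⟨h0, h1⟩
      exact ⟨by linarith, by linarith⟩
    have key := ih (fun i x => f i (x + t) - f i x) (m * t) (2 * δ) ?_ ?_ ?_
    · calc m * t ^ (r + 1) = m * t * t ^ r := by ring
        _ ≤ 2 ^ r * (2 * δ) := key
        _ = 2 ^ (r + 1) * δ := by ring
    · intro i hi x hx
      have h1 := (hf i (by lia) _ (mem_right x hx)).comp x
        (((hasDerivAt_id x).add_const t).hasDerivWithinAt (s := Set.Icc 0 (r * t))) mem_right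
      rw [mul_one] at h1
      exact h1.sub ((hf i (by lia) x (mem_left x hx)).mono mem_left)
    · intro x hx
      have hder : ∀ y ∈ interior (Set.Icc 0 (((r + 1 : ℕ) : ℝ) * t)),
          HasDerivAt (f r) (f (r + 1) y) y := fun y hy =>
        (hf r (by lia) y (interior_subset hy)).hasDerivAt (mem_interior_iff_mem_nhds.mp hy)
      have h := (convex_Icc 0 (((r + 1 : ℕ) : ℝ) * t)).mul_sub_le_image_sub_of_le_deriv
        (fun y hy => (hf r (by lia) y hy).continuousWithinAt)
        (fun y hy => (hder y hy).differentiableAt.differentiableWithinAt)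
        (fun y hy => (hder y hy).deriv ▸ hm y (interior_subset hy))
        x (mem_left x hx) (x + t) (mem_right x hx) (by linarith)
      simpa using h
    · intro x hx
      have h1 := hδ x (mem_left x hx)
      have h2 := hδ _ (mem_right x hx)
      have h3 := abs_sub (f 0 (x + t)) (f 0 x)
      change |f 0 (x + t) - f 0 x| ≤ 2 * δ
      linarith

/-- If the `r`-th derivative of a function on `[0, b]` is convex and nonpositive at `0`, then the
function is at distance at least a fixed multiple of `b ^ r` from `x ^ r / r!`. -/
theorem pow_le_mul_of_convexOn_deriv (r : ℕ) (hr : r ≠ 0) {b : ℝ} (hb : 0 ≤ b) (f : ℕ → ℝ → ℝ)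
    (δ : ℝ)
    (hf : ∀ i < r, ∀ x ∈ Set.Icc 0 b, HasDerivWithinAt (f i) (f (i + 1) x) (Set.Icc 0 b) x)
    (hconv : ConvexOn ℝ (Set.Icc 0 b) (f r)) (h0 : f r 0 ≤ 0)
    (hδ : ∀ x ∈ Set.Icc 0 b, |x ^ r / r.factorial - f 0 x| ≤ δ) :
    (b / r) ^ r ≤ 2 ^ r * ((2 ^ (r + 1) + 1) * δ) := by
  have hr' : (r : ℝ) ≠ 0 := by exact_mod_cast hr
  have hbr : r * (b / r) = b := by field_simp
  have half_mem : ∀ x ∈ Set.Icc 0 b, x / 2 ∈ Set.Icc 0 b := by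
    rintro x ⟨h0, h1⟩
    exact ⟨by linarith, by linarith⟩
  set e : ℕ → ℝ → ℝ := fun i x => x ^ (r - i) / (r - i).factorial - f i x with he
  have he' : ∀ i < r, ∀ x ∈ Set.Icc 0 b,
      HasDerivWithinAt (e i) (e (i + 1) x) (Set.Icc 0 b) x := by
    intro i hi x hx
    refine HasDerivWithinAt.sub ?_ (hf i hi x hx)
    obtain ⟨k, rfl⟩ := Nat.exists_eq_add_of_lt hi
    rw [show i + k + 1 - i = k + 1 by lia, show i + k + 1 - (i + 1) = k by lia]
    refine (((hasDerivAt_pow (k + 1) x).div_const _).congr_deriv ?_).hasDerivWithinAt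
    rw [Nat.factorial_succ]
    have := Nat.factorial_ne_zero k
    push_cast
    field_simp
  have key := mul_pow_le_two_pow_mul_of_le_deriv r (t := b / r) (by positivity)
    (fun i x => 2 ^ (r + 1 - i) * e i (x / 2) - e i x) 1 ((2 ^ (r + 1) + 1) * δ)
  rw [hbr, one_mul] at key
  refine key ?_ ?_ ?_
  · intro i hi x hx
    have h1 := (he' i hi _ (half_mem x hx)).comp x
      (((hasDerivAt_id x).div_const 2).hasDerivWithinAt (s := Set.Icc 0 b)) half_mem
    refine ((h1.const_mul (2 ^ (r + 1 - i))).sub (he' i hi x hx)).congr_deriv ?_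
    rw [show r + 1 - i = (r + 1 - (i + 1)) + 1 by lia, pow_succ]
    ring
  · intro x hx
    have h := hconv.2 (Set.left_mem_Icc.mpr hb) hx (show (0 : ℝ) ≤ 1 / 2 by norm_num)
      (show (0 : ℝ) ≤ 1 / 2 by norm_num) (by norm_num)
    simp only [smul_eq_mul, mul_zero, zero_add] at h
    rw [show 1 / 2 * x = x / 2 by ring] at h
    simp only [he, Nat.sub_self, pow_zero, Nat.factorial_zero, Nat.cast_one, div_one,
      show r + 1 - r = 1 by lia, pow_one]
    linarith
  · intro x hx
    have h1 : |e 0 x| ≤ δ := by simpa [he] using hδ x hx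
    have h2 : |e 0 (x / 2)| ≤ δ := by simpa [he] using hδ _ (half_mem x hx)
    calc |2 ^ (r + 1 - 0) * e 0 (x / 2) - e 0 x|
        ≤ |2 ^ (r + 1 - 0) * e 0 (x / 2)| + |e 0 x| := abs_sub _ _
      _ = 2 ^ (r + 1) * |e 0 (x / 2)| + |e 0 x| := by
        rw [abs_mul, abs_of_pos (by positivity), Nat.sub_zero]
      _ ≤ 2 ^ (r + 1) * δ + δ := by gcongr
      _ = (2 ^ (r + 1) + 1) * δ := by ring

theorem Fr_of_nonneg {r : ℕ} (hr : r ≠ 0) {x : ℝ} (hx : 0 ≤ x) : Fr r x = x ^ r / r.factorial := by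
  rw [Fr, abs_of_nonneg hx, mul_pow_sub_one hr]

theorem Fr_neg {r : ℕ} (hr : r ≠ 0) (x : ℝ) : Fr r (-x) = (-1) ^ (r + 1) * Fr r x := by
  obtain ⟨k, rfl⟩ := Nat.exists_eq_succ_of_ne_zero hr
  simp only [Fr, abs_neg, Nat.succ_eq_add_one, Nat.add_sub_cancel]
  rw [neg_pow x]
  ring

/-- **Scaled version of Lemma 2.4.** For each `q ≥ 3` there is `c = c(q) > 0` such that for
every `b > 0` and any `g ∈ C^{q-2}[-b, b]` with `g^{(q-2)}` convex on `[0, b]` and concave on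
`[-b, 0]`, we have `max_{x ∈ [-b, b]} |F_{q-2}(x) - g(x)| ≥ c b^{q-2}`. -/
theorem dist_to_co_convex_scaled (q : ℕ) (hq : 3 ≤ q) :
    ∃ c : ℝ, 0 < c ∧ ∀ b : ℝ, 0 < b → ∀ g : ℝ → ℝ,
      ContDiffOn ℝ (q - 2 : ℕ) g (Set.Icc (-b) b) →
      ConvexOn ℝ (Set.Icc 0 b) (iteratedDerivWithin (q - 2) g (Set.Icc (-b) b)) →
      ConcaveOn ℝ (Set.Icc (-b) 0) (iteratedDerivWithin (q - 2) g (Set.Icc (-b) b)) →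
      c * b ^ (q - 2) ≤ sSup ((fun x => |Fr (q - 2) x - g x|) '' Set.Icc (-b) b) := by
  obtain ⟨r, rfl⟩ : ∃ r, q = r + 2 := ⟨q - 2, by lia⟩
  rw [Nat.add_sub_cancel]
  have hr : r ≠ 0 := by lia
  refine ⟨1 / (r ^ r * (2 ^ r * (2 ^ (r + 1) + 1))), by positivity, ?_⟩
  intro b hb g hg hconv hconc
  set H : ℕ → ℝ → ℝ := fun i => iteratedDerivWithin i g (Set.Icc (-b) b) with hH
  set δ := sSup ((fun x => |Fr r x - g x|) '' Set.Icc (-b) b)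
  have hδ : ∀ x ∈ Set.Icc (-b) b, |Fr r x - g x| ≤ δ := fun x hx =>
    le_csSup (isCompact_Icc.bddAbove_image
      ((continuous_Fr r).continuousOn.sub hg.continuousOn).abs) (Set.mem_image_of_mem _ hx)
  have hder : ∀ i < r, ∀ x ∈ Set.Icc (-b) b,
      HasDerivWithinAt (H i) (H (i + 1) x) (Set.Icc (-b) b) x := by
    intro i hi x hx
    have h := hg.differentiableOn_iteratedDerivWithin (by exact_mod_cast hi)
      (uniqueDiffOn_Icc (by linarith)) x hx
    simpa only [hH, iteratedDerivWithin_succ] using h.hasDerivWithinAt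
  have mem_right : ∀ x ∈ Set.Icc 0 b, x ∈ Set.Icc (-b) b := fun x hx =>
    ⟨by linarith [hx.1], hx.2⟩
  have mem_left : ∀ x ∈ Set.Icc 0 b, -x ∈ Set.Icc (-b) b := fun x hx =>
    ⟨by linarith [hx.2], by linarith [hx.1]⟩
  suffices h : (b / r) ^ r ≤ 2 ^ r * ((2 ^ (r + 1) + 1) * δ) by
    rw [div_pow, div_le_iff₀ (by positivity)] at h
    rw [div_mul_eq_mul_div, one_mul, div_le_iff₀ (by positivity)]
    linarith
  rcases le_total (H r 0) 0 with h0 | h0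
  · refine pow_le_mul_of_convexOn_deriv r hr hb.le H δ
      (fun i hi x hx => (hder i hi x (mem_right x hx)).mono mem_right) hconv h0 fun x hx => ?_
    rw [← Fr_of_nonneg hr hx.1]
    simpa [hH] using hδ x (mem_right x hx)
  · have hsign : ((-1 : ℝ) ^ (r + 1 + r)) = -1 := Odd.neg_one_pow ⟨r, by ring⟩
    refine pow_le_mul_of_convexOn_deriv r hr hb.le (fun i x => (-1) ^ (r + 1 + i) * H i (-x)) δ
      ?_ ?_ ?_ ?_
    · intro i hi x hx
      have h := (hder i hi _ (mem_left x hx)).comp x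
        ((hasDerivAt_neg x).hasDerivWithinAt (s := Set.Icc 0 b)) mem_left
      refine (h.const_mul ((-1) ^ (r + 1 + i))).congr_deriv ?_
      ring
    · refine ⟨convex_Icc 0 b, fun x hx y hy α β hα hβ hαβ => ?_⟩
      have h := hconc.2 (x := -x) ⟨by linarith [hx.2], by linarith [hx.1]⟩ (y := -y)
        ⟨by linarith [hy.2], by linarith [hy.1]⟩ hα hβ hαβ
      simp only [smul_eq_mul] at h ⊢
      rw [hsign, show -(α * x + β * y) = α * -x + β * -y by ring]
      linarith
    · simpa [hsign] using h0
    · intro x hx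
      have h := hδ _ (mem_left x hx)
      have hx' : x ^ r / r.factorial - (-1) ^ (r + 1) * g (-x)
          = (-1) ^ (r + 1) * (Fr r (-x) - g (-x)) := by
        rw [Fr_neg hr, ← Fr_of_nonneg hr hx.1, mul_sub, ← mul_assoc, ← mul_pow]
        norm_num
      simp only [hH, iteratedDerivWithin_zero, add_zero]
      rw [hx', abs_mul, abs_neg_one_pow, one_mul]
      exact h
end
end
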